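/- Let ε ∈ (0,1) and let ℓ be an integer satisfying ⌈(log(ℓ)+1)²⌉ < ⌈ℓ^ε⌉ ≤ ℓ − 2⌈log(ℓ)⌉. Let F be a finite field of odd order, set n = 2ℓ, and let H be the special orthogonal group of n×n matrices M over F satisfying Mᵀ·M = I and det(M) = 1 (the orthogonal group of the standard symmetric bilinear form, intersected with SL_n(F)). Then the proportion of elements h ∈ H such that h has even order and h^{|h|/2} is an involution whose (−1)-eigenspace has dimension at most 2⌈ℓ^ε⌉ is greater than ε/192. -/

import Mathlib

open scoped MatrixGroups Matrix

/-- The dimension of the `(-1)`-eigenspace of a square matrix `M`, i.e. the dimension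
of the kernel of `M + I`. -/
noncomputable def negOneEigDim {m : Type*} [Fintype m] [DecidableEq m]
    (F : Type*) [Field F] (M : Matrix m m F) : ℕ :=
  Module.finrank F (LinearMap.ker (Matrix.toLin' (M + 1)))


set_option linter.unusedSectionVars false


/-- The isometry group of the Gram matrix `S`. -/
def OG {ι F : Type*} [Fintype ι] [DecidableEq ι] [Field F] (S : Matrix ι ι F) :
    Subgroup (GL ι F) where
  carrier := {g | (g : Matrix ι ι F)ᵀ * S * (g : Matrix ι ι F) = S}
  mul_mem' := by
    intro a b ha hb
    simp only [Set.mem_ofPred_eq, Units.val_mul, Matrix.transpose_mul] at *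
    calc _ = (b : Matrix ι ι F)ᵀ * ((a : Matrix ι ι F)ᵀ * S * (a : Matrix ι ι F)) * b := by
          simp only [Matrix.mul_assoc]
      _ = S := by rw [ha, hb]
  one_mem' := by simp
  inv_mem' := by
    intro a ha
    simp only [Set.mem_ofPred_eq] at *
    have h1 : (a : Matrix ι ι F) * ((a⁻¹ : GL ι F) : Matrix ι ι F) = 1 := by
      rw [← Units.val_mul]; simp
    have h2 : ((a⁻¹ : GL ι F) : Matrix ι ι F)ᵀ * (a : Matrix ι ι F)ᵀ = 1 := by
      rw [← Matrix.transpose_mul, h1]; simp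
    calc _ = ((a⁻¹ : GL ι F) : Matrix ι ι F)ᵀ *
          ((a : Matrix ι ι F)ᵀ * S * (a : Matrix ι ι F)) * ((a⁻¹ : GL ι F) : Matrix ι ι F) := by
            rw [ha]
      _ = (((a⁻¹ : GL ι F) : Matrix ι ι F)ᵀ * (a : Matrix ι ι F)ᵀ) * S *
        ((a : Matrix ι ι F) * ((a⁻¹ : GL ι F) : Matrix ι ι F)) := by
          simp only [Matrix.mul_assoc]
      _ = S := by rw [h1, h2]; simp


section witt
variable {ι F : Type*} [Fintype ι] [DecidableEq ι] [Field F]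

theorem mem_OG {S : Matrix ι ι F} {g : GL ι F} :
    g ∈ OG S ↔ (g : Matrix ι ι F)ᵀ * S * (g : Matrix ι ι F) = S := Iff.rfl

theorem mem_OG_one {g : GL ι F} :
    g ∈ OG (1 : Matrix ι ι F) ↔ (g : Matrix ι ι F)ᵀ * (g : Matrix ι ι F) = 1 := by
  rw [mem_OG, Matrix.mul_one]

theorem OG_dot {g : GL ι F} (hg : g ∈ OG (1 : Matrix ι ι F)) (x y : ι → F) :
    ((g : Matrix ι ι F) *ᵥ x) ⬝ᵥ ((g : Matrix ι ι F) *ᵥ y) = x ⬝ᵥ y := by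
  rw [Matrix.dotProduct_mulVec, Matrix.vecMul_mulVec, (mem_OG_one.1 hg)]
  simp

/-- Reflections. -/
theorem exists_refl (w : ι → F) (hw : w ⬝ᵥ w ≠ 0) :
    ∃ g ∈ OG (1 : Matrix ι ι F), ∀ x : ι → F,
      (g : Matrix ι ι F) *ᵥ x = x - (2 * (w ⬝ᵥ x) / (w ⬝ᵥ w)) • w := by
  set c : F := 2 / (w ⬝ᵥ w) with hc
  set M : Matrix ι ι F := 1 - c • Matrix.vecMulVec w w with hM
  have hMt : Mᵀ = M := by
    simp [hM, Matrix.transpose_vecMulVec]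
  have hVV : Matrix.vecMulVec w w * Matrix.vecMulVec w w = (w ⬝ᵥ w) • Matrix.vecMulVec w w := by
    rw [Matrix.vecMulVec_mul_vecMulVec]
    ext i j; simp [Matrix.vecMulVec]
    try ring
  have hcc : c * c * (w ⬝ᵥ w) = 2 * c := by
    rw [hc]; field_simp
  have hMM : M * M = 1 := by
    rw [hM]
    simp only [Matrix.sub_mul, Matrix.mul_sub, Matrix.one_mul, Matrix.mul_one, Matrix.smul_mul,
      Matrix.mul_smul, hVV]
    ext i j
    simp only [Matrix.sub_apply, Matrix.smul_apply, smul_eq_mul]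
    linear_combination Matrix.vecMulVec w w i j * hcc
  refine ⟨⟨M, M, hMM, hMM⟩, ?_, ?_⟩
  · rw [mem_OG_one]; simp only [hMt, hMM]
  · intro x
    simp only [hM, Matrix.sub_mulVec, Matrix.one_mulVec, Matrix.smul_mulVec]
    congr 1
    ext i
    simp [Matrix.vecMulVec_mulVec, hc]
    ring

theorem witt_step (h2 : (2 : F) ≠ 0) (x y : ι → F) (hxy : x ⬝ᵥ x = y ⬝ᵥ y) (hx : x ⬝ᵥ x ≠ 0) :
    ∃ g ∈ OG (1 : Matrix ι ι F), (g : Matrix ι ι F) *ᵥ x = y ∧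
      ∀ z : ι → F, x ⬝ᵥ z = 0 → y ⬝ᵥ z = 0 → (g : Matrix ι ι F) *ᵥ z = z := by
  have hyx : y ⬝ᵥ x = x ⬝ᵥ y := dotProduct_comm _ _
  by_cases hd : (x - y) ⬝ᵥ (x - y) = 0
  · have hs : (x + y) ⬝ᵥ (x + y) ≠ 0 := by
      intro hs
      apply hx
      simp only [sub_dotProduct, dotProduct_sub, add_dotProduct, dotProduct_add] at hd hs
      have : (2 * 2 : F) * (x ⬝ᵥ x) = 0 := by
        linear_combination hd + hs + 2 * hxy
      simpa [h2] using this
    obtain ⟨g, hg, hgx⟩ := exists_refl (x + y) hs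
    obtain ⟨g', hg', hgx'⟩ := exists_refl y (hxy ▸ hx)
    have hc1 : 2 * ((x + y) ⬝ᵥ x) / ((x + y) ⬝ᵥ (x + y)) = 1 := by
      rw [div_eq_one_iff_eq hs]
      simp only [add_dotProduct, dotProduct_add]
      linear_combination hxy + hyx
    have hgxx : (g : Matrix ι ι F) *ᵥ x = -y := by
      rw [hgx, hc1]; simp
    refine ⟨g' * g, mul_mem hg' hg, ?_, ?_⟩
    · rw [Units.val_mul, ← Matrix.mulVec_mulVec, hgxx, hgx']
      have : y ⬝ᵥ y ≠ 0 := hxy ▸ hx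
      have e : 2 * (y ⬝ᵥ -y) / (y ⬝ᵥ y) = -2 := by
        rw [dotProduct_neg]; field_simp
      rw [e]
      ext i; simp; ring
    · intro z h1 h3
      rw [Units.val_mul, ← Matrix.mulVec_mulVec, hgx z, hgx']
      simp [add_dotProduct, h1, h3]
  · obtain ⟨g, hg, hgx⟩ := exists_refl (x - y) hd
    have hc1 : 2 * ((x - y) ⬝ᵥ x) / ((x - y) ⬝ᵥ (x - y)) = 1 := by
      rw [div_eq_one_iff_eq hd]
      simp only [sub_dotProduct, dotProduct_sub]
      linear_combination hxy - hyx
    refine ⟨g, hg, ?_, ?_⟩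
    · rw [hgx, hc1]; simp
    · intro z h1 h3
      rw [hgx z]
      simp [sub_dotProduct, h1, h3]

theorem witt_orth {κ : Type*} [DecidableEq κ] (h2 : (2 : F) ≠ 0) (e e' : κ → ι → F)
    (he : ∀ i j, i ≠ j → e i ⬝ᵥ e j = 0) (he' : ∀ i j, i ≠ j → e' i ⬝ᵥ e' j = 0)
    (hn : ∀ i, e i ⬝ᵥ e i = e' i ⬝ᵥ e' i) (hz : ∀ i, e i ⬝ᵥ e i ≠ 0) (s : Finset κ) :
    ∃ g ∈ OG (1 : Matrix ι ι F), ∀ i ∈ s, (g : Matrix ι ι F) *ᵥ e i = e' i := by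
  induction s using Finset.induction_on with
  | empty => exact ⟨1, one_mem _, by simp⟩
  | insert k s hk ih =>
    obtain ⟨g, hg, hgs⟩ := ih
    obtain ⟨r, hr, hr1, hr2⟩ := witt_step h2 ((g : Matrix ι ι F) *ᵥ e k) (e' k)
      (by rw [OG_dot hg, hn]) (by rw [OG_dot hg]; exact hz k)
    refine ⟨r * g, mul_mem hr hg, ?_⟩
    intro i hi
    rw [Units.val_mul, ← Matrix.mulVec_mulVec]
    rcases Finset.mem_insert.1 hi with rfl | hi
    · exact hr1
    · have hik : k ≠ i := by rintro rfl; exact hk hi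
      rw [hr2 _ (by rw [OG_dot hg]; exact he _ _ hik)
        (by rw [hgs i hi]; exact he' _ _ hik), hgs i hi]

/-- Dual isotropic family. -/
theorem exists_dual {μ : Type*} [Fintype μ] [DecidableEq μ] (h2 : (2 : F) ≠ 0) (u : μ → ι → F)
    (hu : LinearIndependent F u) (hi : ∀ i j, u i ⬝ᵥ u j = 0) :
    ∃ w : μ → ι → F, (∀ i j, u i ⬝ᵥ w j = if i = j then 1 else 0) ∧ ∀ i j, w i ⬝ᵥ w j = 0 := by
  have hsurj : Function.Surjective (Matrix.of u).mulVec := by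
    have h3 : (Matrix.of u).rank = Fintype.card μ := LinearIndependent.rank_matrix hu
    have h4 : LinearMap.range (Matrix.of u).mulVecLin = ⊤ := by
      apply Submodule.eq_top_of_finrank_eq
      rw [Module.finrank_fintype_fun_eq_card, ← h3]; rfl
    exact LinearMap.range_eq_top.1 h4
  choose w' hw' using fun j : μ => hsurj (Pi.single j 1)
  have huw : ∀ i j, u i ⬝ᵥ w' j = if i = j then 1 else 0 := by
    intro i j
    have := congrFun (hw' j) i
    simpa [Matrix.mulVec, Pi.single_apply] using this
  have hwu : ∀ i j, w' j ⬝ᵥ u i = if i = j then 1 else 0 := by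
    intro i j; rw [dotProduct_comm, huw]
  refine ⟨fun j => w' j - (2⁻¹ : F) • ∑ k, (w' j ⬝ᵥ w' k) • u k, ?_, ?_⟩
  · intro i j
    simp [dotProduct_sub, dotProduct_sum, hi, huw]
  · intro i j
    simp only [dotProduct_sub, dotProduct_sum, hi, huw, hwu, sub_dotProduct, sum_dotProduct,
      smul_dotProduct, dotProduct_smul, smul_eq_mul]
    simp
    rw [dotProduct_comm (w' j) (w' i)]
    field_simp
    ring

theorem witt_iso {μ : Type*} [Fintype μ] [DecidableEq μ] (h2 : (2 : F) ≠ 0) (u u' : μ → ι → F)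
    (hu : LinearIndependent F u) (hi : ∀ i j, u i ⬝ᵥ u j = 0)
    (hu' : LinearIndependent F u') (hi' : ∀ i j, u' i ⬝ᵥ u' j = 0) :
    ∃ g ∈ OG (1 : Matrix ι ι F), ∀ i, (g : Matrix ι ι F) *ᵥ u i = u' i := by
  obtain ⟨w, hw, hww⟩ := exists_dual h2 u hu hi
  obtain ⟨w', hw', hww'⟩ := exists_dual h2 u' hu' hi'
  let E : (μ → ι → F) → (μ → ι → F) → (μ ⊕ μ) → ι → F := fun u w =>
    Sum.elim (fun i => u i + (2⁻¹ : F) • w i) (fun i => u i - (2⁻¹ : F) • w i)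
  have hE : ∀ u w : μ → ι → F, (∀ i j, u i ⬝ᵥ u j = 0) →
      (∀ i j, u i ⬝ᵥ w j = if i = j then 1 else 0) → (∀ i j, w i ⬝ᵥ w j = 0) →
      (∀ i j, E u w i ⬝ᵥ E u w j = if i = j then Sum.elim (fun _ => 1) (fun _ => -1) i else 0) := by
    intro u w h1 h3 h4
    have h5 : ∀ i j, w i ⬝ᵥ u j = if i = j then 1 else 0 := by
      intro i j; rw [dotProduct_comm, h3]; simp only [eq_comm]
    have h22 : (2⁻¹ : F) + 2⁻¹ = 1 := by field_simp; norm_num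
    rintro (i | i) (j | j) <;>
    simp only [E, Sum.elim_inl, Sum.elim_inr, add_dotProduct, sub_dotProduct, dotProduct_add,
      dotProduct_sub, smul_dotProduct, dotProduct_smul, smul_eq_mul, h1, h3, h4, h5] <;>
    by_cases hij : i = j
    all_goals simp only [hij, Sum.inl.injEq, Sum.inr.injEq, if_true,
      if_false, reduceCtorEq]
    all_goals first | linear_combination h22 | linear_combination -h22 | ring
  have A := hE u w hi hw hww
  have A' := hE u' w' hi' hw' hww'
  obtain ⟨g, hg, hgs⟩ := witt_orth h2 (E u w) (E u' w')
    (fun i j hij => by rw [A, if_neg hij]) (fun i j hij => by rw [A', if_neg hij])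
    (fun i => by rw [A, A']) (fun i => by rw [A]; rcases i with i | i <;> simp) Finset.univ
  refine ⟨g, hg, fun i => ?_⟩
  have e : ∀ u w : μ → ι → F, u i = (2⁻¹ : F) • (E u w (Sum.inl i) + E u w (Sum.inr i)) := by
    intro u w
    ext k; simp [E]; field_simp; ring
  rw [e u w, e u' w', Matrix.mulVec_smul, Matrix.mulVec_add, hgs _ (Finset.mem_univ _),
    hgs _ (Finset.mem_univ _)]

end witt


section eigen
variable {ι F K : Type*} [Fintype ι] [DecidableEq ι] [Field F] [Field K] [Algebra F K]

/-- `v` is an eigenvector over `K` of the matrix `M` over `F`. -/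
def IsEV (M : Matrix ι ι F) (α : K) (v : ι → K) : Prop :=
  M.map (algebraMap F K) *ᵥ v = α • v

theorem exists_IsEV_iff (M : Matrix ι ι F) (α : K) :
    (∃ v, v ≠ 0 ∧ IsEV M α v) ↔ Polynomial.aeval α M.charpoly = 0 := by
  have h : Polynomial.aeval α M.charpoly
      = (Matrix.scalar ι α - M.map (algebraMap F K)).det := by
    rw [← Matrix.eval_charpoly, Matrix.charpoly_map, Polynomial.eval_map_algebraMap]
  rw [h, ← Matrix.exists_mulVec_eq_zero_iff]
  refine exists_congr fun v => and_congr_right fun _ => ?_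
  rw [IsEV, Matrix.sub_mulVec, sub_eq_zero]
  have : (Matrix.scalar ι α) *ᵥ v = α • v := by
    ext i; simp [Matrix.scalar_apply, Matrix.mulVec_diagonal]
  rw [this, eq_comm]

theorem comp_mulVec (M : Matrix ι ι F) (v : ι → K) (l : K →ₗ[F] F) :
    (fun i => l ((M.map (algebraMap F K) *ᵥ v) i)) = M *ᵥ (fun i => l (v i)) := by
  ext i
  simp only [Matrix.mulVec, dotProduct, map_sum, Matrix.map_apply]
  refine Finset.sum_congr rfl fun j _ => ?_
  rw [← Algebra.smul_def, map_smul, smul_eq_mul]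

theorem isotropic_of_IsEV {h : GL ι F} (hh : h ∈ OG (1 : Matrix ι ι F)) {α : K} {v : ι → K}
    (hv : IsEV (h : Matrix ι ι F) α v)
    (hα : Polynomial.aeval α⁻¹ (minpoly F α) ≠ 0) (l m : K →ₗ[F] F) :
    (fun i => l (v i)) ⬝ᵥ (fun i => m (v i)) = 0 := by
  have hα0 : α ≠ 0 := by
    rintro rfl
    simp at hα
  have C1 : ∀ y z : K, (fun i => l (α * y * v i)) ⬝ᵥ (fun i => m (α * z * v i))
      = (fun i => l (y * v i)) ⬝ᵥ (fun i => m (z * v i)) := by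
    intro y z
    have e : ∀ (l : K →ₗ[F] F) (y : K), (fun i => l (α * y * v i))
        = (h : Matrix ι ι F) *ᵥ (fun i => l (y * v i)) := by
      intro l y
      have := comp_mulVec (h : Matrix ι ι F) v (l ∘ₗ LinearMap.mulLeft F y)
      rw [hv] at this
      simp only [LinearMap.comp_apply, LinearMap.mulLeft_apply, Pi.smul_apply, smul_eq_mul] at this
      rw [← this]
      ext i; congr 1; ring
    rw [e l, e m, OG_dot hh]
  have C2 : ∀ y z : K, (fun i => l (α * y * v i)) ⬝ᵥ (fun i => m (z * v i))
      = (fun i => l (y * v i)) ⬝ᵥ (fun i => m (α⁻¹ * z * v i)) := by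
    intro y z
    rw [← C1 y (α⁻¹ * z), mul_inv_cancel_left₀ hα0]
  have C3 : ∀ (n : ℕ) (y z : K), (fun i => l (α ^ n * y * v i)) ⬝ᵥ (fun i => m (z * v i))
      = (fun i => l (y * v i)) ⬝ᵥ (fun i => m (α⁻¹ ^ n * z * v i)) := by
    intro n
    induction n with
    | zero => intro y z; simp
    | succ n ih =>
      intro y z
      rw [pow_succ, mul_assoc (α ^ n), ih, C2, pow_succ' α⁻¹, mul_assoc (α⁻¹)]
  have C4 : ∀ (p : Polynomial F) (z : K),
      (fun i => l (Polynomial.aeval α p * v i)) ⬝ᵥ (fun i => m (z * v i))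
      = (fun i => l (v i)) ⬝ᵥ (fun i => m (Polynomial.aeval α⁻¹ p * z * v i)) := by
    intro p z
    induction p using Polynomial.induction_on' with
    | add p q hp hq =>
      simp only [map_add, add_mul]
      have e1 : (fun i => l (Polynomial.aeval α p * v i) + l (Polynomial.aeval α q * v i)) =
        (fun i => l (Polynomial.aeval α p * v i)) + (fun i => l (Polynomial.aeval α q * v i)) := rfl
      have e2 : (fun i => m (Polynomial.aeval α⁻¹ p * z * v i)
          + m (Polynomial.aeval α⁻¹ q * z * v i)) =
        (fun i => m (Polynomial.aeval α⁻¹ p * z * v i)) +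
          (fun i => m (Polynomial.aeval α⁻¹ q * z * v i)) := rfl
      rw [e1, e2, add_dotProduct, dotProduct_add, hp, hq]
    | monomial n a =>
      simp only [Polynomial.aeval_monomial, ← Algebra.smul_def, smul_mul_assoc, map_smul]
      have e1 : (fun i => a • l (α ^ n * v i)) = a • (fun i => l (α ^ n * v i)) := rfl
      have e2 : (fun i => a • m (α⁻¹ ^ n * z * v i)) = a • (fun i => m (α⁻¹ ^ n * z * v i)) := rfl
      have := C3 n 1 z
      simp only [mul_one, one_mul] at this
      rw [e1, e2, smul_dotProduct, dotProduct_smul, this]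
  have := C4 (minpoly F α) ((Polynomial.aeval α⁻¹ (minpoly F α))⁻¹)
  rw [minpoly.aeval, mul_inv_cancel₀ hα] at this
  simp only [zero_mul, map_zero, one_mul] at this
  rw [← this]
  exact zero_dotProduct _

theorem indep_of_IsEV {M : Matrix ι ι F} {α : K} {v : ι → K} (hv : IsEV M α v) (hv0 : v ≠ 0)
    (hα : Algebra.adjoin F {α} = ⊤) (l : K →ₗ[F] F) (hl : ∀ i, l (v i) = 0) : l = 0 := by
  have C : ∀ n : ℕ, ∀ i, l (α ^ n * v i) = 0 := by
    intro n
    induction n with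
    | zero => simpa using hl
    | succ n ih =>
      have := comp_mulVec M v (l ∘ₗ LinearMap.mulLeft F (α ^ n))
      rw [hv] at this
      simp only [LinearMap.comp_apply, LinearMap.mulLeft_apply, Pi.smul_apply, smul_eq_mul] at this
      intro i
      have h2 := congrFun this i
      have h3 : (fun i => l (α ^ n * v i)) = 0 := by ext i; exact ih i
      rw [h3, Matrix.mulVec_zero] at h2
      rw [pow_succ, mul_assoc]; exact h2
  have C' : ∀ p : Polynomial F, ∀ i, l (Polynomial.aeval α p * v i) = 0 := by
    intro p i
    induction p using Polynomial.induction_on' with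
    | add p q hp hq => simp [add_mul, hp, hq]
    | monomial n a =>
      rw [Polynomial.aeval_monomial, ← Algebra.smul_def, smul_mul_assoc, map_smul, C, smul_zero]
  obtain ⟨i, hi⟩ : ∃ i, v i ≠ 0 := by
    by_contra hcon; push Not at hcon; exact hv0 (funext hcon)
  ext y
  have hy : y / v i ∈ Algebra.adjoin F {α} := by rw [hα]; trivial
  rw [Algebra.adjoin_singleton_eq_range_aeval] at hy
  obtain ⟨p, hp⟩ := hy
  have := C' p i
  rw [show Polynomial.aeval α p = y / v i from hp, div_mul_cancel₀ _ hi] at this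
  simpa using this

theorem trans_of_IsEV [FiniteDimensional F K] (h2 : (2 : F) ≠ 0) {h h' : GL ι F}
    (hh : h ∈ OG (1 : Matrix ι ι F)) (hh' : h' ∈ OG (1 : Matrix ι ι F)) {α : K} {v v' : ι → K}
    (hv : IsEV (h : Matrix ι ι F) α v) (hv' : IsEV (h' : Matrix ι ι F) α v')
    (hv0 : v ≠ 0) (hv0' : v' ≠ 0)
    (hα : Polynomial.aeval α⁻¹ (minpoly F α) ≠ 0) (hα' : Algebra.adjoin F {α} = ⊤) :
    ∃ g ∈ OG (1 : Matrix ι ι F), (g : Matrix ι ι F).map (algebraMap F K) *ᵥ v = v' := by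
  let b := Module.finBasis F K
  have key : ∀ (h : GL ι F) (v : ι → K), IsEV (h : Matrix ι ι F) α v → v ≠ 0 →
      LinearIndependent F (fun j i => b.coord j (v i)) := by
    intro h v hv hv0
    rw [Fintype.linearIndependent_iff]
    intro c hc
    have := indep_of_IsEV hv hv0 hα' (∑ j, c j • b.coord j) (by
      intro i
      have := congrFun hc i
      simpa using this)
    intro j
    have := LinearMap.congr_fun this (b j)
    simpa [Finsupp.single_apply] using this
  obtain ⟨g, hg, hgs⟩ := witt_iso h2 (fun j i => b.coord j (v i)) (fun j i => b.coord j (v' i))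
    (key h v hv hv0) (fun i j => isotropic_of_IsEV hh hv hα _ _)
    (key h' v' hv' hv0') (fun i j => isotropic_of_IsEV hh' hv' hα _ _)
  refine ⟨g, hg, ?_⟩
  ext i
  apply b.ext_elem
  intro j
  have := comp_mulVec (g : Matrix ι ι F) v (b.coord j)
  rw [hgs j] at this
  exact congrFun this i

theorem map_mulVec_mul (g h : GL ι F) (v : ι → K) :
    ((g * h : GL ι F) : Matrix ι ι F).map (algebraMap F K) *ᵥ v =
    (g : Matrix ι ι F).map (algebraMap F K) *ᵥ ((h : Matrix ι ι F).map (algebraMap F K) *ᵥ v) := by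
  rw [Units.val_mul, Matrix.map_mul, Matrix.mulVec_mulVec]

theorem IsEV.inv {h : GL ι F} {α : K} {v : ι → K} (hα : α ≠ 0)
    (hv : IsEV (h : Matrix ι ι F) α v) : IsEV ((h⁻¹ : GL ι F) : Matrix ι ι F) α⁻¹ v := by
  have h1 := map_mulVec_mul h⁻¹ h v
  rw [hv, inv_mul_cancel, Matrix.mulVec_smul] at h1
  simp only [Units.val_one] at h1
  rw [Matrix.map_one _ (map_zero _) (map_one _), Matrix.one_mulVec] at h1
  rw [IsEV]
  conv_rhs => rw [h1]
  rw [smul_smul, inv_mul_cancel₀ hα, one_smul]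

theorem exists_IsEV_inv {h : GL ι F} (hh : h ∈ OG (1 : Matrix ι ι F)) {α : K} (hα : α ≠ 0)
    (hv : Polynomial.aeval α (h : Matrix ι ι F).charpoly = 0) :
    Polynomial.aeval α⁻¹ (h : Matrix ι ι F).charpoly = 0 := by
  obtain ⟨v, hv0, hv⟩ := (exists_IsEV_iff _ _).2 hv
  have h1 : (h : Matrix ι ι F)ᵀ = ((h⁻¹ : GL ι F) : Matrix ι ι F) := by
    have := mem_OG_one.1 hh
    calc (h : Matrix ι ι F)ᵀ = (h : Matrix ι ι F)ᵀ * ((h * h⁻¹ : GL ι F) : Matrix ι ι F) := by simp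
      _ = _ := by rw [Units.val_mul, ← Matrix.mul_assoc, this, Matrix.one_mul]
  rw [← Matrix.charpoly_transpose, h1]
  exact (exists_IsEV_iff _ _).1 ⟨v, hv0, hv.inv hα⟩

theorem card_pairs_le [FiniteDimensional F K] [Finite F] [Finite K] (h2 : (2 : F) ≠ 0) {α : K}
    (hα : Polynomial.aeval α⁻¹ (minpoly F α) ≠ 0) (hα' : Algebra.adjoin F {α} = ⊤) :
    Nat.card {p : GL ι F × (ι → K) // p.1 ∈ OG (1 : Matrix ι ι F) ∧ p.2 ≠ 0 ∧
      IsEV (p.1 : Matrix ι ι F) α p.2} ≤ Nat.card (OG (1 : Matrix ι ι F)) := by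
  have hα0 : α ≠ 0 := by
    rintro rfl
    simp at hα
  rcases isEmpty_or_nonempty {p : GL ι F × (ι → K) // p.1 ∈ OG (1 : Matrix ι ι F) ∧ p.2 ≠ 0 ∧
      IsEV (p.1 : Matrix ι ι F) α p.2} with he | ⟨⟨⟨h0, v0⟩, hh0, hv0, hev⟩⟩
  · simp
  choose g hg hgv using fun p : {p : GL ι F × (ι → K) // p.1 ∈ OG (1 : Matrix ι ι F) ∧ p.2 ≠ 0 ∧
      IsEV (p.1 : Matrix ι ι F) α p.2} =>
    trans_of_IsEV h2 hh0 p.2.1 hev p.2.2.2 hv0 p.2.2.1 hα hα'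
  classical
  let G : (ι → K) → GL ι F := fun v =>
    if hv : ∃ h, h ∈ OG (1 : Matrix ι ι F) ∧ v ≠ 0 ∧ IsEV (h : Matrix ι ι F) α v
    then g ⟨(hv.choose, v), hv.choose_spec⟩ else 1
  have hG : ∀ h v, h ∈ OG (1 : Matrix ι ι F) → v ≠ 0 → IsEV (h : Matrix ι ι F) α v →
      G v ∈ OG (1 : Matrix ι ι F) ∧ ((G v : GL ι F) : Matrix ι ι F).map (algebraMap F K) *ᵥ v0
        = v := by
    intro h v h1 h3 h4
    have hv : ∃ h, h ∈ OG (1 : Matrix ι ι F) ∧ v ≠ 0 ∧ IsEV (h : Matrix ι ι F) α v :=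
      ⟨h, h1, h3, h4⟩
    simp only [G, dif_pos hv]
    exact ⟨hg _, hgv _⟩
  refine Nat.card_le_card_of_injective (fun p => ⟨p.1.1 * G p.1.2 * h0⁻¹,
    mul_mem (mul_mem p.2.1 (hG _ _ p.2.1 p.2.2.1 p.2.2.2).1) (inv_mem hh0)⟩) ?_
  have hrec : ∀ p : {p : GL ι F × (ι → K) // p.1 ∈ OG (1 : Matrix ι ι F) ∧ p.2 ≠ 0 ∧
      IsEV (p.1 : Matrix ι ι F) α p.2},
      ((p.1.1 * G p.1.2 * h0⁻¹ : GL ι F) : Matrix ι ι F).map (algebraMap F K) *ᵥ v0 = p.1.2 := by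
    intro p
    rw [map_mulVec_mul, hev.inv hα0, Matrix.mulVec_smul, map_mulVec_mul,
      (hG _ _ p.2.1 p.2.2.1 p.2.2.2).2, p.2.2.2, smul_smul, inv_mul_cancel₀ hα0, one_smul]
  intro p p' hpp
  simp only [Subtype.mk.injEq] at hpp
  have hv : p.1.2 = p'.1.2 := by rw [← hrec p, ← hrec p', hpp]
  have : p.1.1 = p'.1.1 := by
    have := hpp
    rw [hv] at this
    simpa using this
  exact Subtype.ext (Prod.ext this hv)

end eigen


section fin
variable {F K : Type*} [Field F] [Fintype F] [Field K] [Algebra F K] [Finite K]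

theorem gen_pow_inj {α : K} (hα : Algebra.adjoin F {α} = ⊤) {i j : ℕ}
    (hi : i < Module.finrank F K) (hj : j < Module.finrank F K)
    (h : α ^ (Fintype.card F ^ i) = α ^ (Fintype.card F ^ j)) : i = j := by
  have hb := (FiniteField.bijective_frobeniusAlgEquivOfAlgebraic_pow F K).1
  have e : ∀ i : ℕ, ∀ x : K, (FiniteField.frobeniusAlgEquivOfAlgebraic F K ^ i) x
      = x ^ (Fintype.card F ^ i) := by
    intro i x
    rw [AlgEquiv.coe_pow, FiniteField.coe_frobeniusAlgEquivOfAlgebraic_iterate]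
  have h3 : FiniteField.frobeniusAlgEquivOfAlgebraic F K ^ i
      = FiniteField.frobeniusAlgEquivOfAlgebraic F K ^ j := by
    have : ((FiniteField.frobeniusAlgEquivOfAlgebraic F K ^ i : Gal(K/F)) : K →ₐ[F] K)
        = ((FiniteField.frobeniusAlgEquivOfAlgebraic F K ^ j : Gal(K/F)) : K →ₐ[F] K) := by
      apply AlgHom.ext_of_adjoin_eq_top hα
      rintro x rfl
      simpa [e] using h
    ext x
    exact DFunLike.congr_fun this x
  have := @hb ⟨i, hi⟩ ⟨j, hj⟩ h3
  simpa using this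

theorem pow_root_conj {f : Polynomial F} {α : K} (i : ℕ) (h : Polynomial.aeval α f = 0) :
    Polynomial.aeval (α ^ (Fintype.card F ^ i)) f = 0 := by
  have e : ∀ x : K, (FiniteField.frobeniusAlgEquivOfAlgebraic F K ^ i) x
      = x ^ (Fintype.card F ^ i) := by
    intro x
    rw [AlgEquiv.coe_pow, FiniteField.coe_frobeniusAlgEquivOfAlgebraic_iterate]
  rw [← e]
  have := Polynomial.aeval_algHom_apply
    ((FiniteField.frobeniusAlgEquivOfAlgebraic F K ^ i : Gal(K/F)) : K →ₐ[F] K) α f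
  rw [h, map_zero] at this
  exact this

theorem pow_mul_inv_ne {q t : ℕ} (hq : Odd q) (ht : ∀ i, ¬ 2 ^ t ∣ q ^ i + 1) {α : K}
    (hα0 : α ≠ 0) (hα : 2 ^ t ∣ orderOf α) (i j : ℕ) : α ^ (q ^ i) ≠ (α ^ (q ^ j))⁻¹ := by
  intro h
  have h1 : α ^ (q ^ i + q ^ j) = 1 := by
    rw [pow_add, h, inv_mul_cancel₀ (pow_ne_zero _ hα0)]
  have h2 : 2 ^ t ∣ q ^ i + q ^ j := hα.trans (orderOf_dvd_of_pow_eq_one h1)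
  have hc : ∀ k, Nat.Coprime (2 ^ t) (q ^ k) := fun k =>
    Nat.Coprime.pow _ _ (Nat.coprime_two_left.2 hq)
  rcases le_total i j with hij | hij
  · obtain ⟨k, rfl⟩ := Nat.exists_eq_add_of_le hij
    have : q ^ i + q ^ (i + k) = q ^ i * (q ^ k + 1) := by ring
    rw [this] at h2
    exact ht k ((hc i).dvd_of_dvd_mul_left h2)
  · obtain ⟨k, rfl⟩ := Nat.exists_eq_add_of_le hij
    have : q ^ (j + k) + q ^ j = q ^ j * (q ^ k + 1) := by ring
    rw [this] at h2
    exact ht k ((hc j).dvd_of_dvd_mul_left h2)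

theorem root_minpoly_pow {α β : K} (h : Polynomial.aeval β (minpoly F α) = 0) :
    ∃ i < Module.finrank F K, β = α ^ (Fintype.card F ^ i) := by
  have h1 : IsConjRoot F β α := ((isConjRoot_iff_aeval_eq_zero (IsIntegral.of_finite F α)).2 h).symm
  obtain ⟨σ, hσ⟩ := isConjRoot_iff_exists_algEquiv.1 h1
  obtain ⟨⟨i, hi⟩, hi'⟩ := (FiniteField.bijective_frobeniusAlgEquivOfAlgebraic_pow F K).2 σ
  refine ⟨i, hi, ?_⟩
  rw [← hσ, ← hi', AlgEquiv.coe_pow, FiniteField.coe_frobeniusAlgEquivOfAlgebraic_iterate]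

theorem not_conj_inv {t : ℕ} (hq : Odd (Fintype.card F))
    (ht : ∀ i, ¬ 2 ^ t ∣ (Fintype.card F) ^ i + 1) {α : K}
    (hα0 : α ≠ 0) (hα : 2 ^ t ∣ orderOf α) : Polynomial.aeval α⁻¹ (minpoly F α) ≠ 0 := by
  intro h
  obtain ⟨i, -, hi⟩ := root_minpoly_pow h
  have := pow_mul_inv_ne hq ht hα0 hα i 0
  apply this
  rw [← hi]; simp

theorem orderOf_frob_pow (i : ℕ) (a : K) : orderOf (a ^ (Fintype.card F ^ i)) = orderOf a := by
  have e : (FiniteField.frobeniusAlgEquivOfAlgebraic F K ^ i) a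
      = a ^ (Fintype.card F ^ i) := by
    rw [AlgEquiv.coe_pow, FiniteField.coe_frobeniusAlgEquivOfAlgebraic_iterate]
  rw [← e]
  exact MulEquiv.orderOf_eq
    ((FiniteField.frobeniusAlgEquivOfAlgebraic F K ^ i : Gal(K/F)) : K ≃* K) a

theorem adjoin_frob_pow (i : ℕ) (a : K) (ha : Algebra.adjoin F {a} = ⊤) :
    Algebra.adjoin F {a ^ (Fintype.card F ^ i)} = ⊤ := by
  have e : (FiniteField.frobeniusAlgEquivOfAlgebraic F K ^ i) a
      = a ^ (Fintype.card F ^ i) := by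
    rw [AlgEquiv.coe_pow, FiniteField.coe_frobeniusAlgEquivOfAlgebraic_iterate]
  rw [← e]
  have := AlgHom.map_adjoin
    ((FiniteField.frobeniusAlgEquivOfAlgebraic F K ^ i : Gal(K/F)) : K →ₐ[F] K) {a}
  rw [ha, Algebra.map_top, Set.image_singleton] at this
  refine Eq.trans this.symm ?_
  exact (AlgHom.range_eq_top _).2 (AlgEquiv.surjective _)

theorem mem_adjoin_inv (a : K)  :
    a ∈ Algebra.adjoin F {a⁻¹}  := by
  by_cases hx : a = 0
  · rw [hx]; exact zero_mem _
  have h3 : ∃ n, a = a⁻¹ ^ n := by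
    have := Fintype.ofFinite K
    refine ⟨Fintype.card K - 2, ?_⟩
    have h1 := FiniteField.pow_card_sub_one_eq_one a⁻¹ (inv_ne_zero hx)
    have hc : Fintype.card K - 1 = Fintype.card K - 2 + 1 := by
      have := Fintype.one_lt_card (α := K); omega
    rw [hc, pow_succ] at h1
    rw [eq_inv_of_mul_eq_one_left h1, inv_inv]
  obtain ⟨n, hn⟩ := h3
  have h4 : a⁻¹ ^ n ∈ Algebra.adjoin F {a⁻¹} :=
    pow_mem (Algebra.subset_adjoin (Set.mem_singleton _)) _
  rw [← hn] at h4
  exact h4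

theorem adjoin_inv_top (a : K) (ha : Algebra.adjoin F {a} = ⊤) :
    Algebra.adjoin F {a⁻¹} = ⊤ := by
  rw [eq_top_iff, ← ha]
  apply Algebra.adjoin_le
  intro x hx
  rw [Set.mem_singleton_iff] at hx
  rw [hx]
  exact mem_adjoin_inv a

theorem card_bad_m {ι : Type*} [Fintype ι] [DecidableEq ι] {t m : ℕ} (hq : Odd (Fintype.card F))
    (h2 : (2 : F) ≠ 0) (hm : Module.finrank F K = m)
    (ht : ∀ i, ¬ 2 ^ t ∣ (Fintype.card F) ^ i + 1) :
    2 * m * Nat.card {h : GL ι F // h ∈ OG (1 : Matrix ι ι F) ∧ ∃ α : K, α ≠ 0 ∧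
      2 ^ t ∣ orderOf α ∧ Algebra.adjoin F {α} = ⊤ ∧
      Polynomial.aeval α (h : Matrix ι ι F).charpoly = 0} ≤ Nat.card (OG (1 : Matrix ι ι F)) := by
  classical
  have : Fintype K := Fintype.ofFinite K
  set Bad := {h : GL ι F // h ∈ OG (1 : Matrix ι ι F) ∧ ∃ α : K, α ≠ 0 ∧
      2 ^ t ∣ orderOf α ∧ Algebra.adjoin F {α} = ⊤ ∧
      Polynomial.aeval α (h : Matrix ι ι F).charpoly = 0} with hBad
  let A := {α : Kˣ // 2 ^ t ∣ orderOf (α : K) ∧ Algebra.adjoin F {(α : K)} = ⊤}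
  let P : A → Type _ := fun α => {p : GL ι F × (ι → K) // p.1 ∈ OG (1 : Matrix ι ι F) ∧ p.2 ≠ 0 ∧
      IsEV (p.1 : Matrix ι ι F) (α.1 : K) p.2}
  have hP : ∀ α : A, Nat.card (P α) ≤ Nat.card (OG (1 : Matrix ι ι F)) := fun α =>
    card_pairs_le h2 (not_conj_inv hq ht α.1.ne_zero α.2.1) α.2.2
  have hS : Nat.card (Σ α : A, P α) ≤ Nat.card Kˣ * Nat.card (OG (1 : Matrix ι ι F)) := by
    rw [Nat.card_sigma]
    calc _ ≤ ∑ _α : A, Nat.card (OG (1 : Matrix ι ι F)) := Finset.sum_le_sum fun α _ => hP α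
      _ = Nat.card A * Nat.card (OG (1 : Matrix ι ι F)) := by simp
      _ ≤ _ := Nat.mul_le_mul_right _ (Finite.card_subtype_le _)
  choose α hα0 hα1 hα2 hα3 using fun h : Bad => h.2.2
  -- the eigenvalues
  let ev : Bad → Bool × Fin m → K := fun h x =>
    if x.1 then α h ^ (Fintype.card F ^ (x.2 : ℕ)) else (α h ^ (Fintype.card F ^ (x.2 : ℕ)))⁻¹
  have hev0 : ∀ h x, ev h x ≠ 0 := by
    intro h x
    simp only [ev]; split_ifs <;> simp [hα0 h]
  have hevr : ∀ h x, Polynomial.aeval (ev h x) (h.1 : Matrix ι ι F).charpoly = 0 := by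
    intro h x
    simp only [ev]
    split_ifs
    · exact pow_root_conj _ (hα3 h)
    · exact exists_IsEV_inv h.2.1 (pow_ne_zero _ (hα0 h)) (pow_root_conj _ (hα3 h))
  have hevinj : ∀ h, Function.Injective (ev h) := by
    rintro h ⟨b, i⟩ ⟨b', j⟩ hx
    cases b <;> cases b' <;> simp only [ev, if_true, Bool.false_eq_true, if_false, inv_inj] at hx
    · rw [Fin.ext (gen_pow_inj (hα2 h) (by rw [hm]; exact i.2) (by rw [hm]; exact j.2) hx)]
    · exact absurd hx.symm (pow_mul_inv_ne hq ht (hα0 h) (hα1 h) _ _)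
    · exact absurd hx (pow_mul_inv_ne hq ht (hα0 h) (hα1 h) _ _)
    · rw [Fin.ext (gen_pow_inj (hα2 h) (by rw [hm]; exact i.2) (by rw [hm]; exact j.2) hx)]
  have hevA : ∀ h x, 2 ^ t ∣ orderOf (ev h x) ∧ Algebra.adjoin F {ev h x} = ⊤ := by
    intro h x
    simp only [ev]
    split_ifs
    · exact ⟨by rw [orderOf_frob_pow]; exact hα1 h, adjoin_frob_pow _ _ (hα2 h)⟩
    · refine ⟨?_, adjoin_inv_top _ (adjoin_frob_pow _ _ (hα2 h))⟩
      have : orderOf (α h ^ (Fintype.card F ^ (x.2 : ℕ)))⁻¹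
          = orderOf (α h ^ (Fintype.card F ^ (x.2 : ℕ))) := by
        have e : α h ^ (Fintype.card F ^ (x.2 : ℕ))
          = ((Units.mk0 _ (pow_ne_zero (Fintype.card F ^ (x.2 : ℕ)) (hα0 h)) : Kˣ) : K) := rfl
        rw [e, ← Units.val_inv_eq_inv_val, orderOf_units, orderOf_units, orderOf_inv]
      rw [this, orderOf_frob_pow]; exact hα1 h
  have hvex : ∀ h x, ∃ v : ι → K, v ≠ 0 ∧ IsEV (h.1.1 : Matrix ι ι F) (ev h x) v := by
    intro h x
    exact (exists_IsEV_iff _ (ev h x)).2 (hevr h x)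
  clear_value ev
  choose v hv0 hv using hvex
  let Φ : Bad × (Bool × Fin m) × Kˣ → Σ α : A, P α := fun y =>
    ⟨⟨Units.mk0 _ (hev0 y.1 y.2.1), hevA _ _⟩, ⟨(y.1.1, (y.2.2 : K) • v y.1 y.2.1), y.1.2.1,
      smul_ne_zero y.2.2.ne_zero (hv0 _ _), by
        have := hv y.1 y.2.1
        simp only [IsEV, Units.val_mk0] at this ⊢
        rw [Matrix.mulVec_smul, this, smul_comm]⟩⟩
  have hΦ : Function.Injective Φ := by
    have e1 : ∀ y, ((Φ y).1.1 : K) = ev y.1 y.2.1 := fun y => rfl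
    have e2 : ∀ y, (Φ y).2.1.1 = y.1.1 := fun y => rfl
    have e3 : ∀ y, (Φ y).2.1.2 = (y.2.2 : K) • v y.1 y.2.1 := fun y => rfl
    rintro ⟨h, x, c⟩ ⟨h', x', c'⟩ hy
    have hh : h = h' := by
      apply Subtype.ext
      have := e2 (h, x, c)
      rw [hy, e2] at this
      exact this.symm
    subst hh
    have hx : x = x' := by
      apply hevinj h
      have := e1 (h, x, c)
      rw [hy, e1] at this
      exact this.symm
    subst hx
    have hc : (c : K) • v h x = (c' : K) • v h x := by
      have := e3 (h, x, c)
      rw [hy, e3] at this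
      exact this.symm
    have : c = c' := Units.ext (smul_left_injective K (hv0 h x) hc)
    rw [this]
  have h3 := Nat.card_le_card_of_injective Φ hΦ
  rw [Nat.card_prod, Nat.card_prod, Nat.card_prod] at h3
  simp only [Nat.card_eq_fintype_card (α := Bool), Fintype.card_bool,
    Nat.card_eq_fintype_card (α := Fin m), Fintype.card_fin] at h3
  have h4 := h3.trans hS
  have hpos : 0 < Nat.card Kˣ := Nat.card_pos
  refine Nat.le_of_mul_le_mul_left ?_ hpos
  calc _ = Nat.card Bad * (2 * m * Nat.card Kˣ) := by ring
    _ ≤ _ := h4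

end fin


theorem odd_half_dvd {q m : ℕ} (hq : Odd q) (hm : 2 ∣ m) : 4 ∣ q ^ m - 1 := by
  have h1 : q ^ 2 - 1 ∣ q ^ m - 1 := by
    obtain ⟨k, rfl⟩ := hm
    rw [pow_mul]
    exact Nat.sub_one_dvd_pow_sub_one _ _
  have h2 : 4 ∣ q ^ 2 - 1 := by
    obtain ⟨k, rfl⟩ := hq
    refine ⟨k ^ 2 + k, ?_⟩
    have : (2 * k + 1) ^ 2 = 4 * (k ^ 2 + k) + 1 := by ring
    rw [this]; simp
  exact h2.trans h1

theorem exists_t {q a : ℕ} (hq : Odd q) (hq1 : 1 < q) (ha : 2 ≤ a) :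
    ∃ t, 2 ≤ t ∧ (∀ m, 2 ^ t ∣ q ^ m - 1 → 2 ^ a ∣ m) ∧ (∀ m, 2 ^ a ∣ m → 2 ^ t ∣ q ^ m - 1) ∧
      (∀ i, ¬ 2 ^ t ∣ q ^ i + 1) := by
  have hpos : 0 < q ^ 2 ^ a - 1 := by
    have := Nat.one_lt_pow (pow_ne_zero a two_ne_zero) hq1
    omega
  obtain ⟨t, ht1, ht2⟩ : ∃ t, 2 ^ t ∣ q ^ 2 ^ a - 1 ∧ ¬ 2 ^ (t + 1) ∣ q ^ 2 ^ a - 1 := by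
    refine ⟨padicValNat 2 (q ^ 2 ^ a - 1), pow_padicValNat_dvd, ?_⟩
    exact pow_succ_padicValNat_not_dvd hpos.ne'
  have ht : 2 ≤ t := by
    by_contra h
    apply ht2
    have h4 : 4 ∣ q ^ 2 ^ a - 1 := odd_half_dvd hq (dvd_pow_self 2 (by omega))
    exact (pow_dvd_pow 2 (show t + 1 ≤ 2 by omega)).trans h4
  have hi : ∀ m, 2 ^ t ∣ q ^ m - 1 → 2 ^ a ∣ m := by
    intro m hm
    have h1 := Nat.dvd_gcd hm ht1
    rw [Nat.pow_sub_one_gcd_pow_sub_one] at h1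
    obtain ⟨b, hb, hb'⟩ := (Nat.dvd_prime_pow Nat.prime_two).1 (Nat.gcd_dvd_right m (2 ^ a))
    rcases hb.eq_or_lt with rfl | hlt
    · rw [← hb']; exact Nat.gcd_dvd_left _ _
    exfalso
    rw [hb'] at h1
    apply ht2
    have h2 : q ^ 2 ^ b - 1 ∣ q ^ 2 ^ (a - 1) - 1 := by
      obtain ⟨k, hk⟩ := pow_dvd_pow 2 (show b ≤ a - 1 by omega)
      rw [hk, pow_mul]; exact Nat.sub_one_dvd_pow_sub_one _ _
    have h3 : q ^ 2 ^ a - 1 = (q ^ 2 ^ (a - 1) - 1) * (q ^ 2 ^ (a - 1) + 1) := by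
      have : 2 ^ a = 2 ^ (a - 1) * 2 := by rw [← pow_succ]; congr 1; omega
      rw [this, pow_mul, mul_comm (_ - 1), ← Nat.sq_sub_sq]
    rw [h3, pow_succ]
    exact mul_dvd_mul (h1.trans h2) (hq.pow.add_one).two_dvd
  refine ⟨t, ht, hi, ?_, ?_⟩
  · rintro m ⟨k, rfl⟩
    rw [pow_mul]
    exact ht1.trans (Nat.sub_one_dvd_pow_sub_one _ _)
  · intro i h
    have h1 : 2 ^ t ∣ q ^ (2 * i) - 1 := by
      have : q ^ (2 * i) - 1 = (q ^ i + 1) * (q ^ i - 1) := by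
        rw [mul_comm 2 i, pow_mul, ← Nat.sq_sub_sq]
      rw [this]; exact h.mul_right _
    have h2 := hi _ h1
    have h3 : 4 ∣ 2 * i := (pow_dvd_pow 2 ha).trans h2
    have h4 := odd_half_dvd hq (show 2 ∣ i by omega)
    have h5 : 4 ∣ q ^ i + 1 := (pow_dvd_pow 2 ht).trans h
    have h6 : 0 < q ^ i := pow_pos (by omega) _
    omega

theorem two_pow_dvd_of {d R t : ℕ} (h1 : d ∣ R) (h2 : ¬ d ∣ R / 2) (h3 : 2 ^ t ∣ R) :
    2 ^ t ∣ d := by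
  obtain ⟨e, rfl⟩ := h1
  rcases Nat.even_or_odd e with ⟨f, rfl⟩ | he
  · exfalso; apply h2
    refine ⟨f, ?_⟩
    have : d * (f + f) = 2 * (d * f) := by ring
    omega
  · exact (Nat.Coprime.pow_left t (Nat.coprime_two_left.2 he)).dvd_of_dvd_mul_right h3

section
variable {ι F : Type*} [Fintype ι] [DecidableEq ι] [Field F] [Fintype F]

theorem exists_root (h2 : (2 : F) ≠ 0) {t : ℕ} (ht : 1 ≤ t) (h : GL ι F)
    (hd : 2 ^ t ∣ orderOf h) :
    ∃ α : AlgebraicClosure F, α ≠ 0 ∧ 2 ^ t ∣ orderOf α ∧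
      Polynomial.aeval α (h : Matrix ι ι F).charpoly = 0 := by
  classical
  set R := orderOf h with hR
  have hRpos : 0 < R := orderOf_pos h
  have hReven : 2 ∣ R := (dvd_pow_self 2 (by omega)).trans hd
  have hR2 : 0 < R / 2 := by omega
  have hRR : R / 2 * 2 = R := Nat.div_mul_cancel hReven
  let L := AlgebraicClosure F
  let M : Matrix ι ι L := (h : Matrix ι ι F).map (algebraMap F L)
  have hpow : ∀ k : ℕ, M ^ k = ((h ^ k : GL ι F) : Matrix ι ι F).map (algebraMap F L) := by
    intro k
    rw [Units.val_pow_eq_pow_val, Matrix.map_pow]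
  have hM1 : M ^ (R / 2) ≠ 1 := by
    intro h0
    rw [hpow] at h0
    have : h ^ (R / 2) = 1 := by
      apply Units.ext
      apply Matrix.map_injective (algebraMap F L).injective
      show ((h ^ (R / 2) : GL ι F) : Matrix ι ι F).map (algebraMap F L) = _
      rw [h0, Units.val_one]
      show _ = (1 : Matrix ι ι F).map (algebraMap F L)
      rw [Matrix.map_one _ (map_zero _) (map_one _)]
    have := Nat.le_of_dvd hR2 (orderOf_dvd_of_pow_eq_one this)
    omega
  have hM2 : M ^ R = 1 := by
    rw [hpow, hR, pow_orderOf_eq_one, Units.val_one, Matrix.map_one _ (map_zero _) (map_one _)]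
  have hspec : (-1 : L) ∈ spectrum L (M ^ (R / 2)) := by
    rw [spectrum.mem_iff]
    intro hu
    apply hM1
    have h3 : (algebraMap L (Matrix ι ι L) (-1) - M ^ (R / 2)) * (M ^ (R / 2) - 1) = 0 := by
      simp only [map_neg, map_one]
      have : M ^ (R / 2) * M ^ (R / 2) = 1 := by rw [← pow_add, ← mul_two, hRR, hM2]
      rw [sub_mul, mul_sub, mul_sub, this]; simp
      exact sub_eq_zero.2 (by abel)
    have := hu.mul_right_eq_zero.1 h3
    exact sub_eq_zero.1 this
  have hne : Nonempty ι := by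
    by_contra hι
    rw [not_nonempty_iff] at hι
    exact hM1 (Subsingleton.elim _ _)
  rw [spectrum.map_pow_of_pos _ hR2] at hspec
  obtain ⟨α, hα, hα2⟩ := hspec
  have hα2 : α ^ (R / 2) = -1 := hα2
  have h2L : (1 : L) ≠ -1 := by
    intro hh
    have h3 : (2 : L) = 0 := by linear_combination hh
    apply h2
    apply (algebraMap F L).injective
    rw [map_ofNat, h3, map_zero]
  refine ⟨α, ?_, ?_, ?_⟩
  · intro h0
    rw [h0, zero_pow hR2.ne'] at hα2
    exact one_ne_zero (neg_eq_zero.1 hα2.symm)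
  · apply two_pow_dvd_of (R := R) _ _ hd
    · apply orderOf_dvd_of_pow_eq_one
      rw [← hRR, pow_mul, hα2]; norm_num
    · intro hdv
      rw [orderOf_dvd_iff_pow_eq_one, hα2] at hdv
      exact h2L hdv.symm
  · rw [Matrix.mem_spectrum_iff_isRoot_charpoly, Polynomial.IsRoot, Matrix.charpoly_map,
      Polynomial.eval_map_algebraMap] at hα
    exact hα

theorem exists_root_ext {p : ℕ} [Fact p.Prime] [CharP F p] (h2 : (2 : F) ≠ 0) {t a : ℕ} (ht : 1 ≤ t)
    (hta : ∀ m, 2 ^ t ∣ (Fintype.card F) ^ m - 1 → 2 ^ a ∣ m) (h : GL ι F)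
    (hd : 2 ^ t ∣ orderOf h) :
    ∃ j, 2 ^ a * (j + 1) ≤ Fintype.card ι ∧
      ∃ α : FiniteField.Extension F p (2 ^ a * (j + 1)), α ≠ 0 ∧ 2 ^ t ∣ orderOf α ∧
      Algebra.adjoin F {α} = ⊤ ∧ 
      Polynomial.aeval α (h : Matrix ι ι F).charpoly = 0 := by
  obtain ⟨α, hα0, hαt, hαr⟩ := exists_root h2 ht h hd
  have hintg : IsIntegral F α := Algebra.IsIntegral.isIntegral α
  let K := IntermediateField.adjoin F {α}
  have : FiniteDimensional F K := IntermediateField.adjoin.finiteDimensional hintg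
  have hfr : Module.finrank F K = (minpoly F α).natDegree :=
    IntermediateField.adjoin.finrank hintg
  have : Finite K := Module.finite_of_finite F
  have : Fintype K := Fintype.ofFinite K
  let β : K := IntermediateField.AdjoinSimple.gen F α
  have hβ : algebraMap K (AlgebraicClosure F) β = α :=
    IntermediateField.AdjoinSimple.algebraMap_gen F α
  have hinj : Function.Injective (algebraMap K (AlgebraicClosure F)) := 
    (algebraMap K (AlgebraicClosure F)).injective
  have hβo : orderOf β = orderOf α := by
    rw [← hβ]
    exact (orderOf_injective (algebraMap K (AlgebraicClosure F)).toMonoidHom hinj β).symm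
  have hβ0 : β ≠ 0 := by
    intro h0; rw [h0, map_zero] at hβ; exact hα0 hβ.symm
  have hβr : Polynomial.aeval β (h : Matrix ι ι F).charpoly = 0 := by
    apply hinj
    rw [← Polynomial.aeval_algebraMap_apply, hβ, hαr, map_zero]
  have hβa : Algebra.adjoin F {β} = ⊤ :=
    (IntermediateField.adjoin.powerBasis hintg).adjoin_gen_eq_top
  have hcard : Fintype.card K = Fintype.card F ^ Module.finrank F K := Module.card_eq_pow_finrank
  have hdv : 2 ^ a ∣ Module.finrank F K := by
    apply hta
    rw [← hcard]
    rw [← hβo] at hαt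
    exact hαt.trans (orderOf_dvd_of_pow_eq_one (FiniteField.pow_card_sub_one_eq_one β hβ0))
  have hle : Module.finrank F K ≤ Fintype.card ι := by
    rw [hfr, ← Matrix.charpoly_natDegree_eq_dim (h : Matrix ι ι F)]
    exact Polynomial.natDegree_le_of_dvd (minpoly.dvd F α hαr) (Matrix.charpoly_monic _).ne_zero
  obtain ⟨k, hk⟩ := hdv
  have hkpos : 0 < k := by
    rcases Nat.eq_zero_or_pos k with rfl | h0
    · have : 0 < Module.finrank F K := Module.finrank_pos
      omega
    · exact h0
  obtain ⟨j, rfl⟩ : ∃ j, k = j + 1 := ⟨k - 1, by omega⟩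
  refine ⟨j, hk ▸ hle, ?_⟩
  let e := FiniteField.algEquivExtension F p _ K hk
  refine ⟨e β, ?_, ?_, ?_, ?_⟩
  · simpa using hβ0
  · have : orderOf (e β) = orderOf β := MulEquiv.orderOf_eq e.toMulEquiv β
    rw [this, hβo]; exact hαt
  · have := AlgHom.map_adjoin e.toAlgHom {β}
    rw [hβa, Algebra.map_top, Set.image_singleton] at this
    refine Eq.trans this.symm ?_
    exact (AlgHom.range_eq_top _).2 e.surjective
  · have := Polynomial.aeval_algHom_apply e.toAlgHom β (h : Matrix ι ι F).charpoly
    rw [hβr, map_zero] at this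
    exact this

theorem card_bad_le {p : ℕ} [Fact p.Prime] [CharP F p] (hq : Odd (Fintype.card F))
    (h2 : (2 : F) ≠ 0) {t a ℓ : ℕ} (ht : 1 ≤ t) (ha : 1 ≤ a)
    (hta : ∀ m, 2 ^ t ∣ (Fintype.card F) ^ m - 1 → 2 ^ a ∣ m)
    (ht' : ∀ i, ¬ 2 ^ t ∣ (Fintype.card F) ^ i + 1)
    (hN : Fintype.card ι ≤ 2 * ℓ) (hx : 2 * (1 + Real.log ℓ) ≤ 2 ^ a) :
    4 * Nat.card {h : GL ι F // h ∈ OG (1 : Matrix ι ι F) ∧ 2 ^ t ∣ orderOf h}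
      ≤ Nat.card (OG (1 : Matrix ι ι F)) := by
  set J := Fintype.card ι / 2 ^ a with hJ
  let B : Fin J → Type _ := fun j => {h : GL ι F // h ∈ OG (1 : Matrix ι ι F) ∧
      ∃ α : FiniteField.Extension F p (2 ^ a * ((j : ℕ) + 1)), α ≠ 0 ∧
      2 ^ t ∣ orderOf α ∧ Algebra.adjoin F {α} = ⊤ ∧
      Polynomial.aeval α (h : Matrix ι ι F).charpoly = 0}
  have hB : ∀ j : Fin J, 2 * (2 ^ a * ((j : ℕ) + 1)) * Nat.card (B j) ≤ Nat.card (OG (1 : Matrix ι ι F)) :=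
    fun j => card_bad_m hq h2 (FiniteField.finrank_extension F p _) ht'
  have hex : ∀ h : {h : GL ι F // h ∈ OG (1 : Matrix ι ι F) ∧ 2 ^ t ∣ orderOf h},
      ∃ x : Σ j, B j, x.2.1 = h.1 := by
    intro h
    obtain ⟨j, hj, hα⟩ := exists_root_ext (p := p) h2 ht hta h.1 h.2.2
    refine ⟨⟨⟨j, ?_⟩, ⟨h.1, h.2.1, hα⟩⟩, rfl⟩
    rw [hJ, Nat.lt_iff_add_one_le, Nat.le_div_iff_mul_le (by positivity), mul_comm]
    exact hj
  choose f hf using hex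
  have hfi : Function.Injective f := by
    intro x y hxy
    apply Subtype.ext
    rw [← hf x, ← hf y, hxy]
  have h3 := Nat.card_le_card_of_injective f hfi
  rw [Nat.card_sigma] at h3
  have h4 : (Nat.card {h : GL ι F // h ∈ OG (1 : Matrix ι ι F) ∧ 2 ^ t ∣ orderOf h} : ℝ)
      ≤ ∑ j : Fin J, (Nat.card (B j) : ℝ) := by exact_mod_cast h3
  have h5 : ∀ j : Fin J, (Nat.card (B j) : ℝ) ≤
      (Nat.card (OG (1 : Matrix ι ι F)) / (2 * 2 ^ a) : ℝ) * ((((j : ℕ) + 1 : ℕ) : ℝ))⁻¹ := by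
    intro j
    have := hB j
    have h6 : (2 * (2 ^ a * ((j : ℕ) + 1)) * Nat.card (B j) : ℝ)
      ≤ Nat.card (OG (1 : Matrix ι ι F)) := by exact_mod_cast this
    rw [← div_eq_mul_inv, div_div, le_div_iff₀ (by positivity)]
    push_cast
    linarith
  have h6 : ∑ j : Fin J, ((((j : ℕ) + 1 : ℕ) : ℝ))⁻¹ = (harmonic J : ℝ) := by
    rw [harmonic, Fin.sum_univ_eq_sum_range (fun j => (((j + 1 : ℕ) : ℝ))⁻¹)]
    push_cast
    rfl
  have h7 : (harmonic J : ℝ) ≤ 1 + Real.log ℓ := by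
    rcases Nat.eq_zero_or_pos J with h0 | h0
    · rw [h0]; simp
      have : 0 ≤ Real.log ℓ := Real.log_natCast_nonneg ℓ
      linarith
    refine (harmonic_le_one_add_log J).trans ?_
    have : J ≤ ℓ := by
      calc J ≤ 2 * ℓ / 2 ^ a := Nat.div_le_div_right hN
        _ ≤ 2 * ℓ / 2 := Nat.div_le_div_left (by
            calc 2 = 2 ^ 1 := rfl
              _ ≤ 2 ^ a := Nat.pow_le_pow_right (by norm_num) ha) (by norm_num)
        _ = ℓ := by omega
    gcongr
  have h8 := h4.trans (Finset.sum_le_sum fun j _ => h5 j)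
  rw [← Finset.mul_sum, h6] at h8
  have h9 : (Nat.card (OG (1 : Matrix ι ι F)) / (2 * 2 ^ a) : ℝ) * (harmonic J : ℝ)
      ≤ (Nat.card (OG (1 : Matrix ι ι F)) / (2 * 2 ^ a) : ℝ) * (2 ^ a / 2) := by
    gcongr; linarith
  have h10 : (Nat.card (OG (1 : Matrix ι ι F)) / (2 * 2 ^ a) : ℝ) * (2 ^ a / 2)
      = Nat.card (OG (1 : Matrix ι ι F)) / 4 := by
    field_simp; norm_num
  have : (4 * Nat.card {h : GL ι F // h ∈ OG (1 : Matrix ι ι F) ∧ 2 ^ t ∣ orderOf h} : ℝ)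
      ≤ Nat.card (OG (1 : Matrix ι ι F)) := by linarith
  exact_mod_cast this

theorem det_OG_one {h : GL ι F} (hh : h ∈ OG (1 : Matrix ι ι F)) :
    (h : Matrix ι ι F).det = 1 ∨ (h : Matrix ι ι F).det = -1 := by
  have := congrArg Matrix.det (mem_OG_one.1 hh)
  rw [Matrix.det_mul, Matrix.det_transpose, Matrix.det_one] at this
  exact mul_self_eq_one_iff.1 this

theorem card_OG_le_two_SO : Nat.card (OG (1 : Matrix ι ι F)) ≤
    2 * Nat.card {h : GL ι F // h ∈ OG (1 : Matrix ι ι F) ∧ (h : Matrix ι ι F).det = 1} := by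
  classical
  by_cases hg : ∃ g ∈ OG (1 : Matrix ι ι F), (g : Matrix ι ι F).det = -1
  · obtain ⟨g, hg, hgd⟩ := hg
    let f : OG (1 : Matrix ι ι F) →
      Bool × {h : GL ι F // h ∈ OG (1 : Matrix ι ι F) ∧ (h : Matrix ι ι F).det = 1} := fun h =>
      if hd : (h.1 : Matrix ι ι F).det = 1 then (true, ⟨h.1, h.2, hd⟩) else
        (false, ⟨g * h.1, mul_mem hg h.2, by
          rw [Units.val_mul, Matrix.det_mul, hgd, (det_OG_one h.2).resolve_left hd]; norm_num⟩)
    have hf : Function.Injective f := by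
      intro x y hxy
      simp only [f] at hxy
      split_ifs at hxy with h1 h2 h2
      · exact Subtype.ext (congrArg (fun z => z.2.1) hxy)
      · simp at hxy
      · simp at hxy
      · exact Subtype.ext (mul_left_cancel (congrArg (fun z => z.2.1) hxy))
    have := Nat.card_le_card_of_injective f hf
    rwa [Nat.card_prod, Nat.card_eq_fintype_card (α := Bool), Fintype.card_bool] at this
  · have : Nat.card (OG (1 : Matrix ι ι F)) ≤
      Nat.card {h : GL ι F // h ∈ OG (1 : Matrix ι ι F) ∧ (h : Matrix ι ι F).det = 1} := by
      refine Nat.card_le_card_of_injective (fun h => ⟨h.1, h.2, (det_OG_one h.2).resolve_right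
        fun hd => hg ⟨h.1, h.2, hd⟩⟩) ?_
      intro x y hxy
      exact Subtype.ext (congrArg (fun z => z.1) hxy)
    omega

theorem two_SO_le_card_OG [Nonempty ι] (h2 : (2 : F) ≠ 0) :
    2 * Nat.card {h : GL ι F // h ∈ OG (1 : Matrix ι ι F) ∧ (h : Matrix ι ι F).det = 1} ≤
    Nat.card (OG (1 : Matrix ι ι F)) := by
  classical
  obtain ⟨i0⟩ := ‹Nonempty ι›
  let D : Matrix ι ι F := Matrix.diagonal (Function.update 1 i0 (-1))
  have hDD : D * D = 1 := by
    simp only [D]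
    rw [Matrix.diagonal_mul_diagonal, ← Matrix.diagonal_one]
    congr 1
    ext i
    by_cases h : i = i0
    · subst h; simp
    · simp [h]
  have hDt : Dᵀ = D := by simp [D]
  have hdet : D.det = -1 := by
    simp only [D]
    rw [Matrix.det_diagonal, Finset.prod_update_of_mem (Finset.mem_univ _)]
    simp
  let g : GL ι F := ⟨D, D, hDD, hDD⟩
  have hg : g ∈ OG (1 : Matrix ι ι F) := by
    rw [mem_OG_one]
    show Dᵀ * D = 1
    rw [hDt, hDD]
  let f : Bool × {h : GL ι F // h ∈ OG (1 : Matrix ι ι F) ∧ (h : Matrix ι ι F).det = 1} →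
      OG (1 : Matrix ι ι F) := fun x => if x.1 then ⟨x.2.1, x.2.2.1⟩ else
        ⟨g * x.2.1, mul_mem hg x.2.2.1⟩
  have hm1 : (1 : F) ≠ -1 := by
    intro h; apply h2; linear_combination h
  have hdf : ∀ x, ((f x).1 : Matrix ι ι F).det = if x.1 then 1 else -1 := by
    rintro ⟨b, x⟩
    cases b
    · simp only [f, Bool.false_eq_true, if_false, Units.val_mul, Matrix.det_mul, x.2.2]
      show D.det * 1 = -1
      rw [hdet, mul_one]
    · simp [f, x.2.2]
  have hf : Function.Injective f := by
    intro x y hxy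
    have h1 := hdf x
    rw [hxy, hdf y] at h1
    obtain ⟨b, x⟩ := x
    obtain ⟨b', y⟩ := y
    cases b <;> cases b' <;> simp only [if_true, Bool.false_eq_true, if_false] at h1
    · simpa [f, Subtype.ext_iff] using hxy
    · exact absurd h1 hm1
    · exact absurd h1.symm hm1
    · simpa [f, Subtype.ext_iff] using hxy
  have := Nat.card_le_card_of_injective f hf
  rwa [Nat.card_prod, Nat.card_eq_fintype_card (α := Bool), Fintype.card_bool] at this

theorem card_good_ge {p : ℕ} [Fact p.Prime] [CharP F p] (hq : Odd (Fintype.card F))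
    (h2 : (2 : F) ≠ 0) {t a ℓ : ℕ} (ht : 1 ≤ t) (ha : 1 ≤ a)
    (hta : ∀ m, 2 ^ t ∣ (Fintype.card F) ^ m - 1 → 2 ^ a ∣ m)
    (ht' : ∀ i, ¬ 2 ^ t ∣ (Fintype.card F) ^ i + 1)
    (hN : Fintype.card ι ≤ 2 * ℓ) (hx : 2 * (1 + Real.log ℓ) ≤ 2 ^ a) :
    Nat.card (OG (1 : Matrix ι ι F)) ≤ 4 * Nat.card {h : GL ι F // (h ∈ OG (1 : Matrix ι ι F) ∧
      (h : Matrix ι ι F).det = 1) ∧ ¬ 2 ^ t ∣ orderOf h} := by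
  have h3 := card_bad_le hq h2 ht ha hta ht' hN hx
  have h4 := card_OG_le_two_SO (ι := ι) (F := F)
  have h5 : Nat.card {h : GL ι F // h ∈ OG (1 : Matrix ι ι F) ∧ (h : Matrix ι ι F).det = 1} ≤
    Nat.card {h : GL ι F // h ∈ OG (1 : Matrix ι ι F) ∧ 2 ^ t ∣ orderOf h} +
    Nat.card {h : GL ι F // (h ∈ OG (1 : Matrix ι ι F) ∧
      (h : Matrix ι ι F).det = 1) ∧ ¬ 2 ^ t ∣ orderOf h} := by
    classical
    rw [← Nat.card_sum]
    refine Nat.card_le_card_of_injective (fun h => if hd : 2 ^ t ∣ orderOf h.1 then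
      Sum.inl ⟨h.1, h.2.1, hd⟩ else Sum.inr ⟨h.1, h.2, hd⟩) ?_
    intro x y hxy
    simp only at hxy
    split_ifs at hxy with h1 h2 h2 <;> simpa [Subtype.ext_iff] using hxy
  omega

end


section
variable {U W F : Type*} [Fintype U] [DecidableEq U] [Fintype W] [DecidableEq W] [Field F]

/-- block diagonal embedding -/
def bd : GL U F × GL W F →* GL (U ⊕ W) F where
  toFun x := ⟨Matrix.fromBlocks (x.1 : Matrix U U F) 0 0 (x.2 : Matrix W W F),
    Matrix.fromBlocks ((x.1⁻¹ : GL U F) : Matrix U U F) 0 0 ((x.2⁻¹ : GL W F) : Matrix W W F),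
    by rw [Matrix.fromBlocks_multiply, ← Units.val_mul, ← Units.val_mul]; simp,
    by rw [Matrix.fromBlocks_multiply, ← Units.val_mul, ← Units.val_mul]; simp⟩
  map_one' := by apply Units.ext; simp
  map_mul' x y := by apply Units.ext; simp [Matrix.fromBlocks_multiply]

theorem bd_val (x : GL U F × GL W F) : ((bd x : GL (U ⊕ W) F) : Matrix (U ⊕ W) (U ⊕ W) F) =
    Matrix.fromBlocks (x.1 : Matrix U U F) 0 0 (x.2 : Matrix W W F) := rfl

theorem bd_injective : Function.Injective (bd : GL U F × GL W F →* GL (U ⊕ W) F) := by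
  intro x y h
  have h1 := congrArg (fun z : GL (U ⊕ W) F => (z : Matrix (U ⊕ W) (U ⊕ W) F)) h
  simp only [bd_val] at h1
  rw [Matrix.fromBlocks_inj] at h1
  exact Prod.ext (Units.ext h1.1) (Units.ext h1.2.2.2)

theorem bd_mem {Q : Matrix U U F} {x : GL U F × GL W F} :
    bd x ∈ OG (Matrix.fromBlocks Q 0 0 (1 : Matrix W W F)) ↔ x.1 ∈ OG Q ∧
      x.2 ∈ OG (1 : Matrix W W F) := by
  rw [mem_OG, mem_OG, mem_OG, bd_val, Matrix.fromBlocks_transpose, Matrix.fromBlocks_multiply,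
    Matrix.fromBlocks_multiply, Matrix.fromBlocks_inj]
  simp

theorem eq_zero_of_intertwine {b : Matrix U W F} {D : GL U F} {h : GL W F} {r : ℕ}
    (hr : h ^ r = 1) (hD : IsUnit (((D ^ r : GL U F) : Matrix U U F) - 1))
    (hb : b * (h : Matrix W W F) = (D : Matrix U U F) * b) : b = 0 := by
  have h1 : ∀ n : ℕ, b * ((h ^ n : GL W F) : Matrix W W F) = ((D ^ n : GL U F) : Matrix U U F) * b := by
    intro n
    induction n with
    | zero => simp
    | succ n ih =>
      rw [pow_succ, pow_succ, Units.val_mul, Units.val_mul, ← Matrix.mul_assoc, ih,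
        Matrix.mul_assoc, hb, Matrix.mul_assoc]
  have h2 := h1 r
  rw [hr, Units.val_one, Matrix.mul_one] at h2
  have h3 : (((D ^ r : GL U F) : Matrix U U F) - 1) * b = 0 := by
    rw [Matrix.sub_mul, ← h2, Matrix.one_mul, sub_self]
  obtain ⟨u, hu⟩ := hD
  calc b = ((u⁻¹ : GL U F) : Matrix U U F) * ((u : Matrix U U F) * b) := by
        rw [← Matrix.mul_assoc, ← Units.val_mul]; simp
    _ = 0 := by rw [hu, h3, Matrix.mul_zero]

theorem eq_zero_of_intertwine' {c : Matrix W U F} {D : GL U F} {h : GL W F} {r : ℕ}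
    (hr : h ^ r = 1) (hD : IsUnit (((D ^ r : GL U F) : Matrix U U F) - 1))
    (hc : c * (D : Matrix U U F) = (h : Matrix W W F) * c) : c = 0 := by
  have h1 : ∀ n : ℕ, c * ((D ^ n : GL U F) : Matrix U U F) = ((h ^ n : GL W F) : Matrix W W F) * c := by
    intro n
    induction n with
    | zero => simp
    | succ n ih =>
      rw [pow_succ, pow_succ, Units.val_mul, Units.val_mul, ← Matrix.mul_assoc, ih,
        Matrix.mul_assoc, hc, Matrix.mul_assoc]
  have h2 := h1 r
  rw [hr, Units.val_one, Matrix.one_mul] at h2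
  have h3 : c * (((D ^ r : GL U F) : Matrix U U F) - 1) = 0 := by
    rw [Matrix.mul_sub, h2, Matrix.mul_one, sub_self]
  obtain ⟨u, hu⟩ := hD
  calc c = (c * (u : Matrix U U F)) * ((u⁻¹ : GL U F) : Matrix U U F) := by
        rw [Matrix.mul_assoc, ← Units.val_mul]; simp
    _ = 0 := by rw [hu, h3, Matrix.zero_mul]

theorem block_of_conj {Q : Matrix U U F} {k : GL (U ⊕ W) F}
    (hk : k ∈ OG (Matrix.fromBlocks Q 0 0 (1 : Matrix W W F)))
    {D0 D : GL U F} {h0 h : GL W F} (hkk : k * bd (D0, h0) = bd (D, h) * k)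
    (hD0 : IsUnit (((D0 ^ orderOf h : GL U F) : Matrix U U F) - 1))
    (hD : IsUnit (((D ^ orderOf h0 : GL U F) : Matrix U U F) - 1)) :
    ∃ x : GL U F × GL W F, bd x = k ∧ (x.1 ∈ OG Q ∧ x.2 ∈ OG (1 : Matrix W W F)) ∧
      x.1 * D0 = D * x.1 ∧ x.2 * h0 = h * x.2 := by
  set M : Matrix (U ⊕ W) (U ⊕ W) F := (k : Matrix (U ⊕ W) (U ⊕ W) F) with hM
  have hMb := Matrix.fromBlocks_toBlocks M
  set a := M.toBlocks₁₁
  set b := M.toBlocks₁₂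
  set c := M.toBlocks₂₁
  set d := M.toBlocks₂₂
  have h1 := congrArg (fun z : GL (U ⊕ W) F => (z : Matrix (U ⊕ W) (U ⊕ W) F)) hkk
  simp only [Units.val_mul, bd_val] at h1
  rw [← hM, ← hMb, Matrix.fromBlocks_multiply, Matrix.fromBlocks_multiply,
    Matrix.fromBlocks_inj] at h1
  simp only [Matrix.mul_zero, Matrix.zero_mul, add_zero, zero_add] at h1
  have hb : b = 0 := eq_zero_of_intertwine (pow_orderOf_eq_one h0) hD h1.2.1
  have hc : c = 0 := eq_zero_of_intertwine' (pow_orderOf_eq_one h) hD0 h1.2.2.1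
  have hdet : M.det ≠ 0 := by
    have := k.isUnit
    rw [Matrix.isUnit_iff_isUnit_det] at this
    exact this.ne_zero
  rw [← hMb, hb, Matrix.det_fromBlocks_zero₁₂, mul_ne_zero_iff] at hdet
  refine ⟨(Matrix.GeneralLinearGroup.mkOfDetNeZero a hdet.1,
    Matrix.GeneralLinearGroup.mkOfDetNeZero d hdet.2), ?_⟩
  have hbd : bd (Matrix.GeneralLinearGroup.mkOfDetNeZero a hdet.1,
    Matrix.GeneralLinearGroup.mkOfDetNeZero d hdet.2) = k := by
    apply Units.ext
    rw [bd_val, ← hM, ← hMb, hb, hc]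
    rfl
  refine ⟨hbd, ?_, ?_, ?_⟩
  · rw [← hbd, bd_mem] at hk
    exact hk
  · apply Units.ext; exact h1.1
  · apply Units.ext; exact h1.2.2.2

theorem card_conj_ge [Finite F] {Q : Matrix U U F} {A : Type*} [Finite A] (D : A → GL U F)
    (H : Set (GL W F)) (B C : ℕ)
    (hDH : ∀ α, ∀ h ∈ H, IsUnit ((((D α) ^ orderOf h : GL U F) : Matrix U U F) - 1))
    (hB : ∀ α0, Nat.card {α // ∃ k ∈ OG Q, k * D α0 = D α * k} ≤ B)
    (hC : ∀ α0, Nat.card {z : GL U F // z ∈ OG Q ∧ z * D α0 = D α0 * z} ≤ C) :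
    Nat.card (OG (Matrix.fromBlocks Q 0 0 (1 : Matrix W W F))) * Nat.card A * Nat.card H ≤
      Nat.card {x : GL (U ⊕ W) F // ∃ g ∈ OG (Matrix.fromBlocks Q 0 0 (1 : Matrix W W F)),
        ∃ α, ∃ h ∈ H, x = g * bd (D α, h) * g⁻¹} * (B * C * Nat.card (OG (1 : Matrix W W F))) := by
  classical
  let X := OG (Matrix.fromBlocks Q 0 0 (1 : Matrix W W F)) × A × H
  have : Fintype X := Fintype.ofFinite X
  let Φ : X → GL (U ⊕ W) F := fun x => x.1 * bd (D x.2.1, x.2.2.1) * (x.1 : GL (U ⊕ W) F)⁻¹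
  have key : ∀ x0 : X, Nat.card {x : X // Φ x = Φ x0} ≤
      B * C * Nat.card (OG (1 : Matrix W W F)) := by
    rintro ⟨g0, α0, h0⟩
    let T := {α // ∃ k ∈ OG Q, k * D α0 = D α * k}
    choose ref href1 href2 using fun α : T => α.2
    have hex : ∀ x : {x : X // Φ x = Φ (g0, α0, h0)}, ∃ y : GL U F × GL W F,
        bd y = (x.1.1 : GL (U ⊕ W) F)⁻¹ * g0 ∧
        (y.1 ∈ OG Q ∧ y.2 ∈ OG (1 : Matrix W W F)) ∧
        y.1 * D α0 = D x.1.2.1 * y.1 ∧ y.2 * h0.1 = x.1.2.2.1 * y.2 := by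
      rintro ⟨⟨g, α, h⟩, hx⟩
      apply block_of_conj
      · exact mul_mem (inv_mem g.2) g0.2
      · simp only [Φ] at hx
        have h2 : (g0 : GL (U ⊕ W) F) * bd (D α0, h0.1) =
          (g : GL (U ⊕ W) F) * bd (D α, h.1) * (g : GL (U ⊕ W) F)⁻¹ * g0 := by
          rw [hx]; group
        rw [mul_assoc, h2]; group
      · exact hDH _ _ h.2
      · exact hDH _ _ h0.2
    choose y hy1 hy2 hy3 hy4 using hex
    let τ : {x : X // Φ x = Φ (g0, α0, h0)} → T := fun x => ⟨x.1.2.1, (y x).1, (hy2 x).1, hy3 x⟩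
    let f : {x : X // Φ x = Φ (g0, α0, h0)} →
        (T × {z : GL U F // z ∈ OG Q ∧ z * D α0 = D α0 * z}) × OG (1 : Matrix W W F) := fun x =>
      ((τ x, ⟨(ref (τ x))⁻¹ * (y x).1, mul_mem (inv_mem (href1 _)) (hy2 x).1, by
          rw [mul_assoc, hy3 x]
          have := href2 (τ x)
          rw [← mul_assoc, ← mul_assoc]
          congr 1
          rw [inv_mul_eq_iff_eq_mul, ← mul_assoc, this]
          simp [τ]⟩), ⟨(y x).2, (hy2 x).2⟩)
    have hf : Function.Injective f := by
      intro x x' hxx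
      have e1 : τ x = τ x' := congrArg (fun z => z.1.1) hxx
      have e2 : (ref (τ x))⁻¹ * (y x).1 = (ref (τ x'))⁻¹ * (y x').1 :=
        congrArg (fun z => z.1.2.1) hxx
      have e3 : (y x).2 = (y x').2 := congrArg (fun z => z.2.1) hxx
      rw [e1] at e2
      have e4 := mul_left_cancel e2
      have e5 : y x = y x' := Prod.ext e4 e3
      have e6 : (x.1.1 : GL (U ⊕ W) F)⁻¹ * g0 = (x'.1.1 : GL (U ⊕ W) F)⁻¹ * g0 := by
        rw [← hy1, ← hy1, e5]
      have e7 := inv_injective (mul_right_cancel e6)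
      have e8 : x.1.2.1 = x'.1.2.1 := congrArg Subtype.val e1
      have e9 : x.1.2.2.1 = x'.1.2.2.1 := by
        have h4 := hy4 x
        rw [e3, hy4 x'] at h4
        exact (mul_right_cancel h4).symm
      exact Subtype.ext (Prod.ext (Subtype.ext e7) (Prod.ext e8 (Subtype.ext e9)))
    have h3 := Nat.card_le_card_of_injective f hf
    rw [Nat.card_prod, Nat.card_prod] at h3
    exact h3.trans (Nat.mul_le_mul_right _ (Nat.mul_le_mul (hB α0) (hC α0)))
  have h3 := Finset.card_le_mul_card_image (f := Φ) Finset.univ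
    (B * C * Nat.card (OG (1 : Matrix W W F))) (by
      intro z hz
      obtain ⟨x0, -, rfl⟩ := Finset.mem_image.1 hz
      refine le_trans (le_of_eq ?_) (key x0)
      rw [Nat.card_eq_fintype_card, Fintype.card_subtype])
  have h4 : (Finset.univ.image Φ).card = Nat.card {x : GL (U ⊕ W) F //
      ∃ g ∈ OG (Matrix.fromBlocks Q 0 0 (1 : Matrix W W F)),
        ∃ α, ∃ h ∈ H, x = g * bd (D α, h) * g⁻¹} := by
    symm
    apply Nat.subtype_card
    intro x
    simp only [Finset.mem_image, Finset.mem_univ, true_and, Φ]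
    constructor
    · rintro ⟨⟨g, α, h⟩, rfl⟩
      exact ⟨g, g.2, α, h, h.2, rfl⟩
    · rintro ⟨g, hg, α, h, hh, rfl⟩
      exact ⟨(⟨g, hg⟩, α, ⟨h, hh⟩), rfl⟩
  rw [h4, Finset.card_univ, ← Nat.card_eq_fintype_card, Nat.card_prod, Nat.card_prod] at h3
  rw [mul_assoc]
  exact h3.trans (le_of_eq (mul_comm _ _))
end


section
variable {μ F K : Type*} [Fintype μ] [DecidableEq μ] [Field F] [Field K] [Algebra F K]

/-- the hyperbolic Gram matrix -/
def Jm (μ F : Type*) [DecidableEq μ] [Field F] : Matrix (μ ⊕ μ) (μ ⊕ μ) F :=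
  Matrix.fromBlocks 0 1 1 0

/-- the embedding of the multiplicative group of `K` in a hyperbolic orthogonal group. -/
noncomputable def DK (b : Module.Basis μ F K) : Kˣ →* GL (μ ⊕ μ) F where
  toFun x := ⟨Matrix.fromBlocks (Algebra.leftMulMatrix b (x : K)) 0 0
      (Algebra.leftMulMatrix b ((x⁻¹ : Kˣ) : K))ᵀ,
    Matrix.fromBlocks (Algebra.leftMulMatrix b ((x⁻¹ : Kˣ) : K)) 0 0
      (Algebra.leftMulMatrix b (x : K))ᵀ,
    by
      rw [Matrix.fromBlocks_multiply, ← Matrix.transpose_mul, ← map_mul, ← Units.val_mul]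
      simp,
    by
      rw [Matrix.fromBlocks_multiply, ← Matrix.transpose_mul, ← map_mul, ← Units.val_mul]
      simp⟩
  map_one' := by apply Units.ext; simp
  map_mul' x y := by
    apply Units.ext
    show Matrix.fromBlocks (Algebra.leftMulMatrix b ((x * y : Kˣ) : K)) 0 0
      (Algebra.leftMulMatrix b (((x * y)⁻¹ : Kˣ) : K))ᵀ =
      Matrix.fromBlocks (Algebra.leftMulMatrix b (x : K)) 0 0
      (Algebra.leftMulMatrix b ((x⁻¹ : Kˣ) : K))ᵀ *
      Matrix.fromBlocks (Algebra.leftMulMatrix b (y : K)) 0 0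
      (Algebra.leftMulMatrix b ((y⁻¹ : Kˣ) : K))ᵀ
    rw [Matrix.fromBlocks_multiply]
    rw [← Matrix.transpose_mul, ← map_mul, ← map_mul, ← Units.val_mul, ← Units.val_mul, mul_inv_rev]
    simp only [Matrix.mul_zero, Matrix.zero_mul, add_zero, zero_add]

theorem DK_val (b : Module.Basis μ F K) (x : Kˣ) :
    ((DK b x : GL (μ ⊕ μ) F) : Matrix (μ ⊕ μ) (μ ⊕ μ) F) =
    Matrix.fromBlocks (Algebra.leftMulMatrix b (x : K)) 0 0
      (Algebra.leftMulMatrix b ((x⁻¹ : Kˣ) : K))ᵀ := rfl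

theorem DK_injective (b : Module.Basis μ F K) : Function.Injective (DK b) := by
  intro x y h
  have h1 := congrArg (fun z : GL (μ ⊕ μ) F => (z : Matrix (μ ⊕ μ) (μ ⊕ μ) F)) h
  simp only [DK_val] at h1
  rw [Matrix.fromBlocks_inj] at h1
  exact Units.ext (Algebra.leftMulMatrix_injective b h1.1)

theorem DK_mem (b : Module.Basis μ F K) (x : Kˣ) : DK b x ∈ OG (Jm μ F) := by
  rw [mem_OG, DK_val, Jm, Matrix.fromBlocks_transpose, Matrix.fromBlocks_multiply,
    Matrix.fromBlocks_multiply]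
  simp only [Matrix.mul_zero, Matrix.zero_mul, Matrix.mul_one, Matrix.transpose_zero, add_zero,
    zero_add, Matrix.transpose_transpose]
  rw [← Matrix.transpose_mul, ← map_mul, ← Units.val_mul]
  simp

theorem DK_neg_one (b : Module.Basis μ F K) :
    ((DK b (-1) : GL (μ ⊕ μ) F) : Matrix (μ ⊕ μ) (μ ⊕ μ) F) = -1 := by
  rw [DK_val, inv_neg_one]
  simp only [Units.val_neg, Units.val_one, map_neg, map_one, Matrix.transpose_neg,
    Matrix.transpose_one]
  rw [← Matrix.fromBlocks_one, Matrix.fromBlocks_neg]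
  simp

theorem DK_det (b : Module.Basis μ F K) (x : Kˣ) :
    ((DK b x : GL (μ ⊕ μ) F) : Matrix (μ ⊕ μ) (μ ⊕ μ) F).det = 1 := by
  rw [DK_val, Matrix.det_fromBlocks_zero₁₂, Matrix.det_transpose, ← Matrix.det_mul, ← map_mul,
    ← Units.val_mul]
  simp

theorem isUnit_lm (b : Module.Basis μ F K) {x : K} (hx : x ≠ 0) :
    IsUnit (Algebra.leftMulMatrix b x) := (IsUnit.mk0 x hx).map _

theorem DK_sub_one (b : Module.Basis μ F K) (x : Kˣ) (hx : x ≠ 1) :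
    IsUnit (((DK b x : GL (μ ⊕ μ) F) : Matrix (μ ⊕ μ) (μ ⊕ μ) F) - 1) := by
  have h1 : ∀ y : Kˣ, y ≠ 1 → (y : K) - 1 ≠ 0 := by
    intro y hy h
    apply hy
    apply Units.ext
    rw [Units.val_one]
    exact sub_eq_zero.1 h
  have h2 : ((DK b x : GL (μ ⊕ μ) F) : Matrix (μ ⊕ μ) (μ ⊕ μ) F) - 1 =
    Matrix.fromBlocks (Algebra.leftMulMatrix b ((x : K) - 1)) 0 0
      (Algebra.leftMulMatrix b (((x⁻¹ : Kˣ) : K) - 1))ᵀ := by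
    rw [DK_val, ← Matrix.fromBlocks_one, sub_eq_add_neg, Matrix.fromBlocks_neg,
      Matrix.fromBlocks_add]
    simp [sub_eq_add_neg]
  rw [h2, Matrix.isUnit_iff_isUnit_det, Matrix.det_fromBlocks_zero₁₂, Matrix.det_transpose]
  exact ((Matrix.isUnit_iff_isUnit_det _).1 (isUnit_lm b (h1 x hx))).mul
    ((Matrix.isUnit_iff_isUnit_det _).1 (isUnit_lm b (h1 _ (by simpa using hx))))

theorem DK_root (b : Module.Basis μ F K) (x : Kˣ) :
    Polynomial.aeval (x : K)
      ((DK b x : GL (μ ⊕ μ) F) : Matrix (μ ⊕ μ) (μ ⊕ μ) F).charpoly = 0 := by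
  rw [DK_val, Matrix.charpoly_fromBlocks_zero₁₂, map_mul]
  have : Polynomial.aeval (x : K) (Algebra.leftMulMatrix b (x : K)).charpoly = 0 := by
    apply Algebra.leftMulMatrix_injective b
    rw [← Polynomial.aeval_algHom_apply, Matrix.aeval_self_charpoly, map_zero]
  rw [this, zero_mul]

theorem card_conj_DK [Finite K] (b : Module.Basis μ F K) {A : Type*} (ι : A → Kˣ)
    (hι : Function.Injective ι) (α0 : A) :
    Nat.card {α // ∃ k ∈ OG (Jm μ F), k * DK b (ι α0) = DK b (ι α) * k} ≤ 2 * Fintype.card μ := by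
  classical
  set P := ((DK b (ι α0) : GL (μ ⊕ μ) F) : Matrix (μ ⊕ μ) (μ ⊕ μ) F).charpoly with hP
  have hP0 : P ≠ 0 := (Matrix.charpoly_monic _).ne_zero
  have hdeg : P.natDegree = 2 * Fintype.card μ := by
    rw [hP, Matrix.charpoly_natDegree_eq_dim, Fintype.card_sum, two_mul]
  have hr : ∀ α : {α // ∃ k ∈ OG (Jm μ F), k * DK b (ι α0) = DK b (ι α) * k},
      (ι α.1 : K) ∈ (P.aroots K).toFinset := by
    rintro ⟨α, k, hk, h⟩
    rw [Multiset.mem_toFinset, Polynomial.mem_aroots]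
    refine ⟨hP0, ?_⟩
    have h1 : DK b (ι α) = k * DK b (ι α0) * k⁻¹ := by rw [h]; group
    have h2 := DK_root b (ι α)
    rw [h1, Units.val_mul, Units.val_mul, Matrix.coe_units_inv, Matrix.charpoly_units_conj] at h2
    exact h2
  have h3 := Nat.card_le_card_of_injective (fun α => (⟨_, hr α⟩ : (P.aroots K).toFinset)) (by
    intro x y hxy
    exact Subtype.ext (hι (Units.ext (congrArg Subtype.val hxy))))
  refine h3.trans ?_
  rw [Nat.card_eq_fintype_card, Fintype.card_coe, ← hdeg]
  refine (Multiset.toFinset_card_le _).trans ((Polynomial.card_roots' _).trans ?_)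
  rw [Polynomial.natDegree_map]

theorem aeval_transpose (f : Polynomial F) (M : Matrix μ μ F) :
    Polynomial.aeval Mᵀ f = (Polynomial.aeval M f)ᵀ := by
  induction f using Polynomial.induction_on' with
  | add p q hp hq => simp [hp, hq]
  | monomial n a =>
    rw [Polynomial.aeval_monomial, Polynomial.aeval_monomial, Matrix.transpose_mul,
      Matrix.transpose_pow, Algebra.commutes]
    congr 1
    simp [Matrix.algebraMap_eq_diagonal]

theorem aeval_intertwine (f : Polynomial F) {b A B : Matrix μ μ F} (h : b * B = A * b) :
    b * Polynomial.aeval B f = Polynomial.aeval A f * b := by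
  induction f using Polynomial.induction_on' with
  | add p q hp hq => simp [hp, hq, Matrix.mul_add, Matrix.add_mul]
  | monomial n a =>
    have : b * B ^ n = A ^ n * b := (show SemiconjBy b B A from h).pow_right n
    rw [Polynomial.aeval_monomial, Polynomial.aeval_monomial, ← mul_assoc, ← Algebra.commutes,
      mul_assoc, this, mul_assoc]

theorem card_cent_DK [Finite K] (b : Module.Basis μ F K) (α : Kˣ)
    (hα : Polynomial.aeval (α : K)⁻¹ (minpoly F (α : K)) ≠ 0)
    (hα' : Algebra.adjoin F {(α : K)} = ⊤) :
    Nat.card {z : GL (μ ⊕ μ) F // z ∈ OG (Jm μ F) ∧ z * DK b α = DK b α * z} ≤ Nat.card Kˣ := by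
  classical
  set f := minpoly F (α : K) with hf
  set lm := Algebra.leftMulMatrix b with hlm
  have hf1 : Polynomial.aeval (lm α) f = 0 := by
    rw [Polynomial.aeval_algHom_apply, hf, minpoly.aeval, map_zero]
  have hf2 : IsUnit (Polynomial.aeval (lm ((α⁻¹ : Kˣ) : K))ᵀ f) := by
    rw [aeval_transpose, Polynomial.aeval_algHom_apply, Matrix.isUnit_transpose]
    apply isUnit_lm
    rwa [Units.val_inv_eq_inv_val]
  have key : ∀ z : {z : GL (μ ⊕ μ) F // z ∈ OG (Jm μ F) ∧ z * DK b α = DK b α * z},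
      ∃ β : K, ∃ d : Matrix μ μ F, (z.1 : Matrix (μ ⊕ μ) (μ ⊕ μ) F) = Matrix.fromBlocks (lm β) 0 0 d
        ∧ (lm β)ᵀ * d = 1 := by
    rintro ⟨z, hz, hc⟩
    set M : Matrix (μ ⊕ μ) (μ ⊕ μ) F := (z : Matrix (μ ⊕ μ) (μ ⊕ μ) F) with hM
    have hMb := Matrix.fromBlocks_toBlocks M
    set a := M.toBlocks₁₁
    set b' := M.toBlocks₁₂
    set c := M.toBlocks₂₁
    set d := M.toBlocks₂₂
    have h1 := congrArg (fun z : GL (μ ⊕ μ) F => (z : Matrix (μ ⊕ μ) (μ ⊕ μ) F)) hc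
    simp only [Units.val_mul, DK_val] at h1
    rw [← hM, ← hMb, Matrix.fromBlocks_multiply, Matrix.fromBlocks_multiply,
      Matrix.fromBlocks_inj] at h1
    simp only [Matrix.mul_zero, Matrix.zero_mul, add_zero, zero_add] at h1
    have hb : b' = 0 := by
      have h2 := aeval_intertwine f h1.2.1
      rw [hf1, Matrix.zero_mul] at h2
      exact hf2.mul_left_eq_zero.1 h2
    have hc : c = 0 := by
      have h2 := aeval_intertwine f h1.2.2.1
      rw [hf1, Matrix.mul_zero] at h2
      exact hf2.mul_right_eq_zero.1 h2.symm
    rw [mem_OG, Jm, ← hM, ← hMb, hb, hc, Matrix.fromBlocks_transpose, Matrix.fromBlocks_multiply,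
      Matrix.fromBlocks_multiply, Matrix.fromBlocks_inj] at hz
    simp only [Matrix.mul_zero, Matrix.zero_mul, Matrix.mul_one, Matrix.transpose_zero, add_zero,
      zero_add] at hz
    -- `a` commutes with everything in the image of `lm`
    have hcomm : ∀ x : K, a * lm x = lm x * a := by
      intro x
      have hx : x ∈ Algebra.adjoin F {(α : K)} := hα' ▸ Algebra.mem_top
      rw [Algebra.adjoin_singleton_eq_range_aeval] at hx
      obtain ⟨g, rfl⟩ := hx
      have h3 : lm (Polynomial.aeval (α : K) g) = Polynomial.aeval (lm α) g :=
        (Polynomial.aeval_algHom_apply _ _ _).symm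
      have h4 := aeval_intertwine g h1.1
      refine Eq.trans (congrArg (a * ·) h3) (h4.trans ?_)
      exact congrArg (· * a) h3.symm
    let φ : K →ₗ[F] K := Matrix.toLin b b a
    have hφ : ∀ x, φ x = x * φ 1 := by
      intro x
      have h5 : Matrix.toLin b b (a * lm x) 1 = Matrix.toLin b b (lm x * a) 1 := by rw [hcomm]
      rw [Matrix.toLin_mul b b b, Matrix.toLin_mul b b b] at h5
      simpa [hlm, Algebra.leftMulMatrix, φ] using h5
    have ha : a = lm (φ 1) := by
      apply (Matrix.toLin b b).injective
      ext x
      rw [hlm, Algebra.leftMulMatrix_apply, Matrix.toLin_toMatrix]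
      show φ x = φ 1 * x
      rw [hφ, mul_comm]
    refine ⟨φ 1, d, ?_, ?_⟩
    · rw [← ha]; conv_lhs => rw [← hMb, hb, hc]
    · rw [← ha]; exact hz.2.1
  choose β d h1 h2 using key
  have hβ : ∀ z, β z ≠ 0 := by
    intro z h0
    have h3 := h2 z
    rw [h0, map_zero, Matrix.transpose_zero, Matrix.zero_mul] at h3
    rcases isEmpty_or_nonempty μ with he | he
    · have : (1 : K) = 0 := by
        rw [← b.sum_repr 1]; simp
      exact one_ne_zero this
    · exact zero_ne_one h3
  refine Nat.card_le_card_of_injective (fun z => Units.mk0 (β z) (hβ z)) ?_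
  intro z z' hzz
  have e1 : β z = β z' := congrArg Units.val hzz
  apply Subtype.ext
  apply Units.ext
  rw [h1, h1, ← e1]
  have h3 := h2 z
  have h4 := h2 z'
  rw [← e1] at h4
  have : d z = d z' := by
    have h5 := mul_eq_one_comm.1 h4
    calc d z = (d z' * (lm (β z))ᵀ) * d z := by rw [h5, Matrix.one_mul]
      _ = d z' := by rw [Matrix.mul_assoc, h3, Matrix.mul_one]
  rw [this]

end



section
variable {ι κ F : Type*} [Fintype ι] [DecidableEq ι] [Fintype κ] [DecidableEq κ] [Field F]

theorem negOne_add_rank (M : Matrix ι ι F) :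
    negOneEigDim F M + (M + 1).rank = Fintype.card ι := by
  have h := LinearMap.finrank_range_add_finrank_ker (Matrix.toLin' (M + 1))
  rw [Module.finrank_fintype_fun_eq_card] at h
  rw [negOneEigDim, Matrix.rank, ← Matrix.toLin'_apply', ← h, add_comm]

theorem negOne_conj (g : GL ι F) (M : GL ι F) :
    negOneEigDim F ((g * M * g⁻¹ : GL ι F) : Matrix ι ι F) = negOneEigDim F (M : Matrix ι ι F) := by
  have h1 := negOne_add_rank ((g * M * g⁻¹ : GL ι F) : Matrix ι ι F)
  have h2 := negOne_add_rank (M : Matrix ι ι F)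
  have h3 : ((g * M * g⁻¹ : GL ι F) : Matrix ι ι F) + 1 =
      (g : Matrix ι ι F) * ((M : Matrix ι ι F) + 1) * ((g⁻¹ : GL ι F) : Matrix ι ι F) := by
    rw [Matrix.mul_add, Matrix.add_mul, Units.val_mul, Units.val_mul, Matrix.mul_one,
      ← Units.val_mul g g⁻¹, mul_inv_cancel, Units.val_one]
  rw [h3, Matrix.rank_mul_eq_left_of_isUnit_det, Matrix.rank_mul_eq_right_of_isUnit_det] at h1
  · omega
  · exact (Matrix.isUnit_iff_isUnit_det _).1 g.isUnit
  · exact (Matrix.isUnit_iff_isUnit_det _).1 (g⁻¹).isUnit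

/-- The property of the half power of an element. -/
def GP (k : ℕ) (x : GL ι F) : Prop :=
  Even (orderOf x) ∧ orderOf (x ^ (orderOf x / 2)) = 2 ∧
    negOneEigDim F ((x ^ (orderOf x / 2) : GL ι F) : Matrix ι ι F) = k

theorem GP_map (f : GL ι F ≃* GL κ F)
    (hf : ∀ x : GL ι F, negOneEigDim F ((f x : GL κ F) : Matrix κ κ F) = negOneEigDim F (x : Matrix ι ι F))
    {k : ℕ} {x : GL ι F} (hx : GP k x) : GP k (f x) := by
  unfold GP at *
  rw [MulEquiv.orderOf_eq f x, ← map_pow, MulEquiv.orderOf_eq f, hf]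
  exact hx

/-- reindexing as a group isomorphism -/
def rei (e : ι ≃ κ) : GL ι F ≃* GL κ F :=
  Units.mapEquiv (Matrix.reindexAlgEquiv F F e).toMulEquiv

theorem rei_val (e : ι ≃ κ) (x : GL ι F) :
    ((rei e x : GL κ F) : Matrix κ κ F) = Matrix.reindex e e (x : Matrix ι ι F) := rfl

/-- conjugation followed by reindexing -/
def theta (e : ι ≃ κ) (T : GL ι F) : GL ι F ≃* GL κ F := (MulAut.conj T).trans (rei e)

theorem theta_apply (e : ι ≃ κ) (T x : GL ι F) : theta e T x = rei e (T * x * T⁻¹) := rfl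

theorem negOne_rei (e : ι ≃ κ) (x : GL ι F) :
    negOneEigDim F ((rei e x : GL κ F) : Matrix κ κ F) = negOneEigDim F (x : Matrix ι ι F) := by
  have h1 := negOne_add_rank ((rei e x : GL κ F) : Matrix κ κ F)
  have h2 := negOne_add_rank (x : Matrix ι ι F)
  have h3 : ((rei e x : GL κ F) : Matrix κ κ F) + 1 =
      Matrix.reindex e e ((x : Matrix ι ι F) + 1) := by
    rw [rei_val, Matrix.reindex_apply, Matrix.reindex_apply, Matrix.submatrix_add]
    simp
  rw [h3, Matrix.rank_reindex, ← Fintype.card_congr e] at h1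
  omega

theorem negOne_theta (e : ι ≃ κ) (T x : GL ι F) :
    negOneEigDim F ((theta e T x : GL κ F) : Matrix κ κ F) = negOneEigDim F (x : Matrix ι ι F) := by
  rw [theta_apply, negOne_rei, negOne_conj]

theorem det_theta (e : ι ≃ κ) (T x : GL ι F) :
    ((theta e T x : GL κ F) : Matrix κ κ F).det = (x : Matrix ι ι F).det := by
  rw [theta_apply, rei_val, Matrix.det_reindex_self, Units.val_mul, Units.val_mul,
    Matrix.det_mul, Matrix.det_mul, mul_right_comm, ← Matrix.det_mul, ← Units.val_mul,
    mul_inv_cancel, Units.val_one, Matrix.det_one, one_mul]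

theorem mem_theta (e : ι ≃ κ) {T x : GL ι F} {S : Matrix ι ι F}
    (hT : (T : Matrix ι ι F)ᵀ * (T : Matrix ι ι F) = S) :
    theta e T x ∈ OG (1 : Matrix κ κ F) ↔ x ∈ OG S := by
  have h1 : theta e T x ∈ OG (1 : Matrix κ κ F) ↔ T * x * T⁻¹ ∈ OG (1 : Matrix ι ι F) := by
    rw [mem_OG, mem_OG, theta_apply, rei_val, Matrix.transpose_reindex, Matrix.mul_one,
      Matrix.mul_one]
    rw [← Matrix.coe_reindexAlgEquiv F F, ← map_mul]
    exact (map_eq_one_iff _ (Matrix.reindexAlgEquiv F F e).injective)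
  rw [h1, mem_OG, mem_OG, Matrix.mul_one]
  have hu : IsUnit (T : Matrix ι ι F) := T.isUnit
  have hi : (T : Matrix ι ι F) * ((T⁻¹ : GL ι F) : Matrix ι ι F) = 1 := by
    rw [← Units.val_mul, mul_inv_cancel, Units.val_one]
  have hi' : ((T⁻¹ : GL ι F) : Matrix ι ι F) * (T : Matrix ι ι F) = 1 := by
    rw [← Units.val_mul, inv_mul_cancel, Units.val_one]
  have hit : ((T⁻¹ : GL ι F) : Matrix ι ι F)ᵀ * (T : Matrix ι ι F)ᵀ = 1 := by
    rw [← Matrix.transpose_mul, hi, Matrix.transpose_one]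
  have hit' : (T : Matrix ι ι F)ᵀ * ((T⁻¹ : GL ι F) : Matrix ι ι F)ᵀ = 1 := by
    rw [← Matrix.transpose_mul, hi', Matrix.transpose_one]
  rw [Units.val_mul, Units.val_mul, Matrix.transpose_mul, Matrix.transpose_mul]
  set t := (T : Matrix ι ι F)
  set s := ((T⁻¹ : GL ι F) : Matrix ι ι F)
  set y := (x : Matrix ι ι F)
  rw [← hT]
  constructor
  · intro h
    calc yᵀ * (tᵀ * t) * y = (tᵀ * sᵀ) * (yᵀ * (tᵀ * t) * y) * (s * t) := by
          rw [hit', hi', Matrix.one_mul, Matrix.mul_one]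
      _ = tᵀ * (sᵀ * (yᵀ * tᵀ) * (t * y * s)) * t := by simp only [Matrix.mul_assoc]
      _ = tᵀ * t := by rw [h, Matrix.mul_one]
  · intro h
    calc sᵀ * (yᵀ * tᵀ) * (t * y * s) = sᵀ * (yᵀ * (tᵀ * t) * y) * s := by
          simp only [Matrix.mul_assoc]
      _ = (sᵀ * tᵀ) * (t * s) := by rw [h]; simp only [Matrix.mul_assoc]
      _ = 1 := by rw [hit, hi, Matrix.one_mul]

theorem half_lcm {d e t : ℕ} (hd0 : 0 < d) (he0 : 0 < e) (ht : 1 ≤ t) (hd : 2 ^ t ∣ d) (he : ¬ 2 ^ t ∣ e) :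
    Even (Nat.lcm d e) ∧ e ∣ Nat.lcm d e / 2 ∧ ¬ d ∣ Nat.lcm d e / 2 := by
  have h2 : 2 ∣ Nat.lcm d e := (dvd_pow_self 2 (by omega)).trans (hd.trans (Nat.dvd_lcm_left d e))
  have hpos := Nat.lcm_pos hd0 he0
  have h3 : e ∣ Nat.lcm d e / 2 := by
    by_contra hcon
    exact he (two_pow_dvd_of (Nat.dvd_lcm_right d e) hcon (hd.trans (Nat.dvd_lcm_left d e)))
  refine ⟨even_iff_two_dvd.2 h2, h3, ?_⟩
  intro h4
  have := Nat.le_of_dvd (by omega) (Nat.lcm_dvd h4 h3)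
  omega

theorem negOne_bd {U W : Type*} [Fintype U] [DecidableEq U] [Fintype W] [DecidableEq W]
    (h2 : (2 : F) ≠ 0) (D : GL U F) (hD : (D : Matrix U U F) = -1) :
    negOneEigDim F ((bd (D, (1 : GL W F)) : GL (U ⊕ W) F) : Matrix (U ⊕ W) (U ⊕ W) F) =
      Fintype.card U := by
  classical
  have h1 := negOne_add_rank ((bd (D, (1 : GL W F)) : GL (U ⊕ W) F) : Matrix (U ⊕ W) (U ⊕ W) F)
  have h3 : ((bd (D, (1 : GL W F)) : GL (U ⊕ W) F) : Matrix (U ⊕ W) (U ⊕ W) F) + 1 =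
      Matrix.diagonal (Sum.elim (fun _ => (0 : F)) (fun _ => (2 : F))) := by
    rw [bd_val, ← Matrix.fromBlocks_one, Matrix.fromBlocks_add, ← Matrix.fromBlocks_diagonal]
    simp only [hD, Units.val_one, add_zero, neg_add_cancel, Matrix.diagonal_zero]
    congr 1
    ext i j
    by_cases hij : i = j
    · subst hij; simp; norm_num
    · simp [hij]
  rw [h3, Matrix.rank_diagonal, Fintype.card_sum] at h1
  have h4 : Fintype.card {i : U ⊕ W // Sum.elim (fun _ => (0 : F)) (fun _ => (2 : F)) i ≠ 0} =
      Fintype.card W := by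
    symm
    refine Fintype.card_of_bijective
      (f := fun w : W => (⟨Sum.inr w, by simpa using h2⟩ :
        {i : U ⊕ W // Sum.elim (fun _ => (0 : F)) (fun _ => (2 : F)) i ≠ 0})) ⟨?_, ?_⟩
    · intro x y hxy
      simpa using hxy
    · rintro ⟨i | i, hi⟩
      · simp at hi
      · exact ⟨i, rfl⟩
  omega

theorem GP_bd {μ W K : Type*} [Fintype μ] [DecidableEq μ] [Fintype W] [DecidableEq W] [Finite F]
    [Field K] [Algebra F K] [Finite K] (h2 : (2 : F) ≠ 0) (b : Module.Basis μ F K) {t : ℕ}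
    (ht : 1 ≤ t) (α : Kˣ) (hα : 2 ^ t ∣ orderOf α) (h : GL W F) (hh : ¬ 2 ^ t ∣ orderOf h) :
    GP (2 * Fintype.card μ) (bd (DK b α, h)) := by
  classical
  have e1 : orderOf (bd (DK b α, h)) = Nat.lcm (orderOf α) (orderOf h) := by
    rw [orderOf_injective bd bd_injective, Prod.orderOf_mk, orderOf_injective (DK b) (DK_injective b)]
  obtain ⟨hev, hA, hB⟩ := half_lcm (orderOf_pos α) (orderOf_pos h) ht hα hh
  set N := Nat.lcm (orderOf α) (orderOf h) with hN
  have hpow : α ^ (N / 2) = -1 := by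
    have h3 : (α ^ (N / 2)) ^ 2 = 1 := by
      rw [← pow_mul, Nat.div_mul_cancel (even_iff_two_dvd.1 hev)]
      exact orderOf_dvd_iff_pow_eq_one.1 (Nat.dvd_lcm_left _ _)
    have h4 : α ^ (N / 2) ≠ 1 := fun h => hB (orderOf_dvd_iff_pow_eq_one.2 h)
    have h5 : ((α ^ (N / 2) : Kˣ) : K) ^ 2 = 1 := by
      rw [← Units.val_pow_eq_pow_val, h3, Units.val_one]
    rcases mul_self_eq_one_iff.1 ((sq _).symm.trans h5) with h6 | h6
    · exact absurd (Units.ext h6) h4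
    · apply Units.ext; rw [h6]; rfl
  have hp : (bd (DK b α, h)) ^ (N / 2) = bd (DK b (-1), (1 : GL W F)) := by
    rw [← map_pow, Prod.pow_mk, ← map_pow, hpow, orderOf_dvd_iff_pow_eq_one.1 hA]
  refine ⟨by rwa [e1], ?_, ?_⟩
  · rw [e1, orderOf_pow, e1, Nat.gcd_eq_right (Nat.div_dvd_of_dvd (even_iff_two_dvd.1 hev))]
    have : 0 < N := Nat.lcm_pos (orderOf_pos α) (orderOf_pos h)
    exact Nat.div_div_self (even_iff_two_dvd.1 hev) this.ne'
  · rw [e1, hp, negOne_bd h2 _ (DK_neg_one b), Fintype.card_sum, two_mul]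

end


section
variable {μ ν F : Type*} [Fintype μ] [DecidableEq μ] [Fintype ν] [DecidableEq ν] [Field F]

theorem exists_R {p : ℕ} [Fact p.Prime] [CharP F p] (e : ν ⊕ ν ≃ μ) :
    ∃ R : Matrix μ μ F, Rᵀ * R = -1 := by
  obtain ⟨a, b, hab⟩ := CharP.sq_add_sq F p (-1)
  have hab' : (a : F) ^ 2 + (b : F) ^ 2 = -1 := by simpa using hab
  let R' : Matrix (ν ⊕ ν) (ν ⊕ ν) F :=
    Matrix.fromBlocks ((a : F) • 1) (-(b : F) • 1) ((b : F) • 1) ((a : F) • 1)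
  have hR : R'ᵀ * R' = -1 := by
    simp only [R', Matrix.fromBlocks_transpose, Matrix.fromBlocks_multiply, Matrix.transpose_smul,
      Matrix.transpose_one, Matrix.smul_mul, Matrix.mul_smul, Matrix.one_mul, smul_smul, ← add_smul]
    rw [← Matrix.fromBlocks_one, Matrix.fromBlocks_neg]
    have e1 : (a : F) * a + b * b = -1 := by rw [← hab']; ring
    have e2 : -(b : F) * -b + a * a = -1 := by rw [← hab']; ring
    have e3 : (a : F) * -b + b * a = 0 := by ring
    have e4 : -(b : F) * a + a * b = 0 := by ring
    simp only [e1, e2, e3, e4, neg_smul, one_smul, zero_smul, neg_zero]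
    try simp [e1, e2, e3, e4]
  refine ⟨Matrix.reindex e e R', ?_⟩
  rw [Matrix.transpose_reindex, ← Matrix.coe_reindexAlgEquiv F F, ← map_mul, hR, map_neg, map_one]

theorem Jm_mul_Jm : Jm μ F * Jm μ F = 1 := by
  rw [Jm, Matrix.fromBlocks_multiply, ← Matrix.fromBlocks_one]
  simp

theorem exists_P {p : ℕ} [Fact p.Prime] [CharP F p] (h2 : (2 : F) ≠ 0) (e : ν ⊕ ν ≃ μ) :
    ∃ P : GL (μ ⊕ μ) F, (P : Matrix (μ ⊕ μ) (μ ⊕ μ) F)ᵀ * (P : Matrix (μ ⊕ μ) (μ ⊕ μ) F) = Jm μ F := by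
  obtain ⟨R, hR⟩ := exists_R (F := F) (p := p) e
  let P : Matrix (μ ⊕ μ) (μ ⊕ μ) F :=
    Matrix.fromBlocks 1 ((2⁻¹ : F) • 1) R (-((2⁻¹ : F) • R))
  have hP : Pᵀ * P = Jm μ F := by
    simp only [P, Jm, Matrix.fromBlocks_transpose, Matrix.fromBlocks_multiply, Matrix.transpose_smul,
      Matrix.transpose_one, Matrix.transpose_neg, Matrix.smul_mul, Matrix.mul_smul, Matrix.one_mul,
      Matrix.mul_one, Matrix.neg_mul, Matrix.mul_neg, hR, neg_neg, smul_neg, smul_smul]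
    have h3 : (2⁻¹ : F) • (1 : Matrix μ μ F) + (2⁻¹ : F) • (1 : Matrix μ μ F) = 1 := by
      rw [← add_smul, ← two_mul, mul_inv_cancel₀ h2, one_smul]
    rw [h3]
    simp
  have h1 : (Jm μ F * Pᵀ) * P = 1 := by rw [Matrix.mul_assoc, hP, Jm_mul_Jm]
  exact ⟨⟨P, Jm μ F * Pᵀ, mul_eq_one_comm.1 h1, h1⟩, hP⟩

end

section
variable {μ W ι K F : Type*} [Fintype μ] [DecidableEq μ] [Fintype W] [DecidableEq W]
  [Fintype ι] [DecidableEq ι] [Field F] [Fintype F] [Field K] [Algebra F K] [Finite K]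

theorem card_OG_theta (e : (μ ⊕ μ) ⊕ W ≃ ι) (T : GL ((μ ⊕ μ) ⊕ W) F) {S : Matrix ((μ ⊕ μ) ⊕ W) ((μ ⊕ μ) ⊕ W) F}
    (hT : (T : Matrix ((μ ⊕ μ) ⊕ W) ((μ ⊕ μ) ⊕ W) F)ᵀ * (T : Matrix ((μ ⊕ μ) ⊕ W) ((μ ⊕ μ) ⊕ W) F) = S) :
    Nat.card (OG (1 : Matrix ι ι F)) = Nat.card (OG S) :=
  (Nat.card_congr ((theta e T).toEquiv.subtypeEquiv (fun x => (mem_theta e hT).symm))).symm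

theorem good_count {p : ℕ} [Fact p.Prime] [CharP F p] {ν : Type*} [Fintype ν] [DecidableEq ν]
    (hq : Odd (Fintype.card F)) (h2 : (2 : F) ≠ 0)
    {t a ℓ : ℕ} (ht1 : 1 ≤ t) (ha1 : 1 ≤ a)
    (hta : ∀ m, 2 ^ t ∣ Fintype.card F ^ m - 1 → 2 ^ a ∣ m)
    (ht' : ∀ i, ¬ 2 ^ t ∣ Fintype.card F ^ i + 1)
    (hN : Fintype.card W ≤ 2 * ℓ) (hx : 2 * (1 + Real.log ℓ) ≤ 2 ^ a)
    [Nonempty ι] (e0 : ν ⊕ ν ≃ μ) (e : (μ ⊕ μ) ⊕ W ≃ ι) (b : Module.Basis μ F K) :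
    Nat.card {h : GL ι F // h ∈ OG (1 : Matrix ι ι F) ∧ (h : Matrix ι ι F).det = 1} *
      Nat.card {α : Kˣ // 2 ^ t ∣ orderOf α ∧ Algebra.adjoin F {(α : K)} = ⊤} ≤
    Nat.card {h : GL ι F // (h ∈ OG (1 : Matrix ι ι F) ∧ (h : Matrix ι ι F).det = 1) ∧
      GP (2 * Fintype.card μ) h} * (4 * Fintype.card μ * Nat.card Kˣ) := by
  classical
  obtain ⟨P, hP⟩ := exists_P (μ := μ) (F := F) (p := p) h2 e0
  set S : Matrix ((μ ⊕ μ) ⊕ W) ((μ ⊕ μ) ⊕ W) F := Matrix.fromBlocks (Jm μ F) 0 0 (1 : Matrix W W F) with hS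
  let T : GL ((μ ⊕ μ) ⊕ W) F := bd (P, (1 : GL W F))
  have hT : (T : Matrix ((μ ⊕ μ) ⊕ W) ((μ ⊕ μ) ⊕ W) F)ᵀ * (T : Matrix ((μ ⊕ μ) ⊕ W) ((μ ⊕ μ) ⊕ W) F) = S := by
    simp only [T, bd_val, Matrix.fromBlocks_transpose, Matrix.fromBlocks_multiply, hS]
    simp [hP]
  let A := {α : Kˣ // 2 ^ t ∣ orderOf α ∧ Algebra.adjoin F {(α : K)} = ⊤}
  let H : Set (GL W F) := {h | (h ∈ OG (1 : Matrix W W F) ∧ (h : Matrix W W F).det = 1) ∧ ¬ 2 ^ t ∣ orderOf h}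
  have hmain := card_conj_ge (Q := Jm μ F) (A := A) (fun α => DK b α.1) H (2 * Fintype.card μ) (Nat.card Kˣ)
    (by
      intro α h hh
      show IsUnit ((((DK b α.1) ^ orderOf h : GL (μ ⊕ μ) F) : Matrix (μ ⊕ μ) (μ ⊕ μ) F) - 1)
      rw [← map_pow]
      apply DK_sub_one
      intro h3
      exact hh.2 (α.2.1.trans (orderOf_dvd_iff_pow_eq_one.2 h3)))
    (fun α0 => card_conj_DK b (fun α : A => α.1) Subtype.val_injective α0)
    (by
      intro α
      refine card_cent_DK b α.1 (not_conj_inv hq ht' α.1.ne_zero ?_) α.2.2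
      rw [orderOf_units]; exact α.2.1)
  rw [← hS] at hmain
  set X := Nat.card {x : GL ((μ ⊕ μ) ⊕ W) F // ∃ g ∈ OG S, ∃ α : A, ∃ h ∈ H, x = g * bd (DK b α.1, h) * g⁻¹} with hX
  have hH : Nat.card (OG (1 : Matrix W W F)) ≤ 4 * Nat.card H :=
    card_good_ge (p := p) hq h2 ht1 ha1 hta ht' hN hx
  have hH0 : 0 < Nat.card H := by
    have h1 : 0 < Nat.card (OG (1 : Matrix W W F)) := Nat.card_pos
    omega
  have hSO := two_SO_le_card_OG (ι := ι) (F := F) h2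
  rw [card_OG_theta e T hT] at hSO
  have hXG : X ≤ Nat.card {h : GL ι F // (h ∈ OG (1 : Matrix ι ι F) ∧ (h : Matrix ι ι F).det = 1) ∧
      GP (2 * Fintype.card μ) h} := by
    rw [hX]
    refine Nat.card_le_card_of_injective (fun x => ⟨theta e T x.1, ?_⟩) ?_
    · obtain ⟨x, g, hg, α, h, hh, rfl⟩ := x
      have hbm : bd (DK b α.1, h) ∈ OG S := bd_mem.2 ⟨DK_mem b α.1, hh.1.1⟩
      refine ⟨⟨(mem_theta e hT).2 ((OG S).mul_mem ((OG S).mul_mem hg hbm) ((OG S).inv_mem hg)), ?_⟩, ?_⟩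
      · rw [det_theta, Units.val_mul, Units.val_mul, Matrix.det_mul, Matrix.det_mul, mul_right_comm,
          ← Matrix.det_mul, ← Units.val_mul, mul_inv_cancel, Units.val_one, Matrix.det_one, one_mul,
          bd_val, Matrix.det_fromBlocks_zero₁₂]
        show ((DK b α.1 : GL (μ ⊕ μ) F) : Matrix (μ ⊕ μ) (μ ⊕ μ) F).det * (h : Matrix W W F).det = 1
        rw [DK_det, hh.1.2, one_mul]
      · apply GP_map _ (negOne_theta e T)
        exact GP_map (MulAut.conj g) (fun x => negOne_conj g x)
          (GP_bd h2 b ht1 α.1 α.2.1 h hh.2)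
    · intro x y hxy
      exact Subtype.ext ((theta e T).injective (congrArg Subtype.val hxy))
  set N := Nat.card {h : GL ι F // h ∈ OG (1 : Matrix ι ι F) ∧ (h : Matrix ι ι F).det = 1}
  set G := Nat.card {h : GL ι F // (h ∈ OG (1 : Matrix ι ι F) ∧ (h : Matrix ι ι F).det = 1) ∧
      GP (2 * Fintype.card μ) h}
  set c := Nat.card Kˣ
  set cA := Nat.card A
  set cH := Nat.card H
  set m := Fintype.card μ
  show N * cA ≤ G * (4 * m * c)
  have h5 : (2 * N) * cA * cH ≤ (G * (2 * (4 * m * c))) * cH :=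
    calc (2 * N) * cA * cH ≤ Nat.card (OG S) * cA * cH := by gcongr
      _ ≤ _ := hmain
      _ ≤ G * (2 * m * c * (4 * cH)) := by gcongr
      _ = _ := by ring
  have h6 := Nat.le_of_mul_le_mul_right h5 hH0
  have h7 : 2 * (N * cA) ≤ 2 * (G * (4 * m * c)) := by
    calc _ = 2 * N * cA := by ring
      _ ≤ _ := h6
      _ = _ := by ring
  omega

end


section
variable {K F : Type*} [Field F] [Fintype F] [Field K] [Algebra F K] [Finite K]

theorem nongen_pow {α : Kˣ} (hα : Algebra.adjoin F {(α : K)} ≠ ⊤) :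
    ∃ d ∈ Finset.Icc 1 (Module.finrank F K / 2), α ^ (Fintype.card F ^ d - 1) = 1 := by
  have : Module.Finite F K := Module.Finite.of_finite
  set E := IntermediateField.adjoin F {(α : K)} with hE
  have hmul := Module.finrank_mul_finrank F E K
  have h1 : Module.finrank E K ≠ 1 := by
    intro h
    rw [IntermediateField.finrank_eq_one_iff_eq_top] at h
    apply hα
    rw [← IntermediateField.adjoin_simple_toSubalgebra_of_isAlgebraic
      (Algebra.IsAlgebraic.isAlgebraic (α : K)), ← hE, h, IntermediateField.top_toSubalgebra]
  have h2 : 0 < Module.finrank E K := Module.finrank_pos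
  have h3 : 0 < Module.finrank F E := Module.finrank_pos
  refine ⟨Module.finrank F E, Finset.mem_Icc.2 ⟨h3, ?_⟩, ?_⟩
  · rw [Nat.le_div_iff_mul_le (by norm_num), ← hmul]
    exact Nat.mul_le_mul_left _ (by omega)
  · have hc : Nat.card E = Fintype.card F ^ Module.finrank F E := by
      rw [Module.natCard_eq_pow_finrank (K := F), Nat.card_eq_fintype_card]
    let x : E := ⟨(α : K), IntermediateField.mem_adjoin_simple_self F _⟩
    have hx0 : x ≠ 0 := fun h => α.ne_zero (congrArg Subtype.val h)
    have hx : x ^ (Nat.card E - 1) = 1 := by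
      have := Fintype.ofFinite E
      rw [Nat.card_eq_fintype_card]
      exact FiniteField.pow_card_sub_one_eq_one x hx0
    apply Units.ext
    rw [← hc, Units.val_pow_eq_pow_val, Units.val_one]
    exact congrArg Subtype.val hx

theorem sum_bound {q : ℕ} (hq : 3 ≤ q) (k : ℕ) :
    2 * ∑ d ∈ Finset.Icc 1 k, (q ^ d - 1) ≤ 3 * (q ^ k - 1) := by
  induction k with
  | zero => simp
  | succ k ih =>
    rw [Finset.sum_Icc_succ_top (by omega)]
    have h1 : 1 ≤ q ^ k := Nat.one_le_pow _ _ (by omega)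
    have h2 : 3 * q ^ k ≤ q ^ (k + 1) := by rw [pow_succ, mul_comm]; gcongr
    omega

theorem card_A_ge (hq : Odd (Fintype.card F)) (hq3 : 3 ≤ Fintype.card F) {t : ℕ}
    (hm : 16 ≤ Module.finrank F K)
    (ht : 2 ^ t ∣ Fintype.card F ^ Module.finrank F K - 1) :
    999 * Nat.card Kˣ ≤
      2000 * Nat.card {α : Kˣ // 2 ^ t ∣ orderOf α ∧ Algebra.adjoin F {(α : K)} = ⊤} := by
  classical
  have : Module.Finite F K := Module.Finite.of_finite
  have := Fintype.ofFinite K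
  set m := Module.finrank F K with hmdef
  set q := Fintype.card F with hqdef
  set k := m / 2 with hk
  have hcK : Nat.card Kˣ = q ^ m - 1 := by
    rw [Nat.card_units, Module.natCard_eq_pow_finrank (K := F), Nat.card_eq_fintype_card]
  set R := q ^ m - 1 with hR
  have hcK' : Fintype.card Kˣ = R := by rw [← Nat.card_eq_fintype_card, hcK]
  have hqm : Odd (q ^ m) := hq.pow
  have hbig : 3 ^ 16 ≤ q ^ m := by
    calc 3 ^ 16 ≤ q ^ 16 := Nat.pow_le_pow_left hq3 _
      _ ≤ q ^ m := Nat.pow_le_pow_right (by omega) hm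
  have hR2 : 2 * (R / 2) = R := by
    obtain ⟨c, hc⟩ := hqm
    omega
  let S0 : Finset Kˣ := Finset.univ.filter (fun α => α ^ (R / 2) = 1)
  let Sd : ℕ → Finset Kˣ := fun d => Finset.univ.filter (fun α => α ^ (q ^ d - 1) = 1)
  let G : Finset Kˣ := Finset.univ.filter (fun α => 2 ^ t ∣ orderOf α ∧ Algebra.adjoin F {(α : K)} = ⊤)
  have hcov : (Finset.univ : Finset Kˣ) ⊆ G ∪ (S0 ∪ (Finset.Icc 1 k).biUnion Sd) := by
    intro α _
    by_cases h1 : Algebra.adjoin F {(α : K)} = ⊤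
    · by_cases h2 : α ^ (R / 2) = 1
      · simp [S0, h2]
      · have h3 : 2 ^ t ∣ orderOf α := by
          refine two_pow_dvd_of (R := R) ?_ ?_ ht
          · rw [← hcK']; exact orderOf_dvd_card
          · exact fun h => h2 (orderOf_dvd_iff_pow_eq_one.1 h)
        simp [G, h1, h3]
    · obtain ⟨d, hd, h2⟩ := nongen_pow h1
      simp only [Finset.mem_union, Finset.mem_biUnion]
      exact Or.inr (Or.inr ⟨d, hd, by simp [Sd, hqdef, h2]⟩)
  have hS0 : S0.card ≤ R / 2 := IsCyclic.card_pow_eq_one_le (by omega)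
  have hSd : ∀ d ∈ Finset.Icc 1 k, (Sd d).card ≤ q ^ d - 1 := by
    intro d hd
    apply IsCyclic.card_pow_eq_one_le
    have : 1 < q ^ d := Nat.one_lt_pow (by have := Finset.mem_Icc.1 hd; omega) (by omega)
    omega
  have h1 := Finset.card_le_card hcov
  rw [Finset.card_univ, hcK'] at h1
  have h2 : R ≤ G.card + (R / 2 + ∑ d ∈ Finset.Icc 1 k, (q ^ d - 1)) := by
    refine h1.trans ((Finset.card_union_le _ _).trans ?_)
    gcongr
    refine (Finset.card_union_le _ _).trans ?_
    gcongr
    exact Finset.card_biUnion_le.trans (Finset.sum_le_sum hSd)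
  have h3 := sum_bound hq3 k
  have h4 : 3000 * (q ^ k - 1) ≤ R := by
    have h5 : 3 ^ 8 ≤ q ^ k := by
      calc 3 ^ 8 ≤ q ^ 8 := Nat.pow_le_pow_left hq3 _
        _ ≤ q ^ k := Nat.pow_le_pow_right (by omega) (by omega)
    have h6 : q ^ k * q ^ k ≤ q ^ m := by
      rw [← pow_add]; exact Nat.pow_le_pow_right (by omega) (by omega)
    have h7 : 3000 * q ^ k ≤ q ^ k * q ^ k := Nat.mul_le_mul_right _ (by omega)
    omega
  have hG : Nat.card {α : Kˣ // 2 ^ t ∣ orderOf α ∧ Algebra.adjoin F {(α : K)} = ⊤} = G.card := by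
    rw [Nat.card_eq_fintype_card, Fintype.card_subtype]
  rw [hG, hcK]
  omega

end

/-- Good elements in dimension `n` with a fixed eigenspace dimension `2 m`. -/
theorem good_m {n ℓ : ℕ} (hn : n = 2 * ℓ) {F : Type*} [Field F] [Fintype F]
    (hq : Odd (Fintype.card F)) {t a m : ℕ} (ht1 : 1 ≤ t) (ha1 : 1 ≤ a)
    (hta : ∀ m, 2 ^ t ∣ Fintype.card F ^ m - 1 → 2 ^ a ∣ m)
    (hta' : ∀ m, 2 ^ a ∣ m → 2 ^ t ∣ Fintype.card F ^ m - 1)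
    (ht' : ∀ i, ¬ 2 ^ t ∣ Fintype.card F ^ i + 1)
    (hx : 2 * (1 + Real.log ℓ) ≤ 2 ^ a) (hm : 16 ≤ m) (ham : 2 ^ a ∣ m) (hmℓ : m ≤ ℓ) :
    999 * Nat.card {h : GL (Fin n) F // h ∈ OG (1 : Matrix (Fin n) (Fin n) F) ∧
        (h : Matrix (Fin n) (Fin n) F).det = 1} ≤
    8000 * m * Nat.card {h : GL (Fin n) F // (h ∈ OG (1 : Matrix (Fin n) (Fin n) F) ∧
      (h : Matrix (Fin n) (Fin n) F).det = 1) ∧ GP (2 * m) h} := by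
  obtain ⟨p, hp⟩ := CharP.exists F
  have hpp : Fact p.Prime := ⟨CharP.char_is_prime F p⟩
  have hp2 : (2 : F) ≠ 0 := by
    apply Ring.two_ne_zero
    intro h
    have := FiniteField.even_card_iff_char_two.1 h
    rw [Nat.odd_iff] at hq
    omega
  have hq3 : 3 ≤ Fintype.card F := by
    have h1 := Fintype.one_lt_card (α := F)
    obtain ⟨c, hc⟩ := hq
    omega
  have hm0 : NeZero m := ⟨by omega⟩
  have hev : Even m := by
    rw [even_iff_two_dvd]
    exact (dvd_pow_self 2 (by omega)).trans ham
  obtain ⟨k, hk⟩ := hev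
  let K := FiniteField.Extension F p m
  have hfr : Module.finrank F K = m := FiniteField.finrank_extension F p m
  have : Finite K := inferInstanceAs (Finite (FiniteField.Extension F p m))
  have : Module.Finite F K := Module.Finite.of_finite
  let b : Module.Basis (Fin m) F K := Module.finBasisOfFinrankEq F K hfr
  have hne : Nonempty (Fin n) := ⟨⟨0, by omega⟩⟩
  have key := good_count (p := p) (K := K) (μ := Fin m) (W := Fin (2 * (ℓ - m))) (ι := Fin n)
    (ν := Fin k) hq hp2 ht1 ha1 hta ht' (ℓ := ℓ) (by rw [Fintype.card_fin]; omega) hx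
    (finSumFinEquiv.trans (finCongr hk.symm))
    (((Equiv.sumCongr finSumFinEquiv (Equiv.refl _)).trans finSumFinEquiv).trans
      (finCongr (by omega))) b
  have hA := card_A_ge (F := F) (K := K) (t := t) hq hq3 (by omega) (by rw [hfr]; exact hta' m ham)
  rw [Fintype.card_fin] at key
  set N := Nat.card {h : GL (Fin n) F // h ∈ OG (1 : Matrix (Fin n) (Fin n) F) ∧
        (h : Matrix (Fin n) (Fin n) F).det = 1}
  set G := Nat.card {h : GL (Fin n) F // (h ∈ OG (1 : Matrix (Fin n) (Fin n) F) ∧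
      (h : Matrix (Fin n) (Fin n) F).det = 1) ∧ GP (2 * m) h}
  set cA := Nat.card {α : Kˣ // 2 ^ t ∣ orderOf α ∧ Algebra.adjoin F {(α : K)} = ⊤}
  have hc : 0 < Nat.card Kˣ := Nat.card_pos
  set c := Nat.card Kˣ
  refine Nat.le_of_mul_le_mul_right ?_ hc
  calc 999 * N * c = N * (999 * c) := by ring
    _ ≤ N * (2000 * cA) := by gcongr
    _ = 2000 * (N * cA) := by ring
    _ ≤ 2000 * (G * (4 * m * c)) := by gcongr
    _ = _ := by ring


theorem boot {ℓ : ℕ} (h0 : 1 ≤ ℓ) (h : (Real.log ℓ + 2) ^ 2 - 2 ≤ ℓ) : 3 < Real.log ℓ := by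
  have l2 := Real.log_two_gt_d9
  have step : ∀ (k r s : ℕ), 1 ≤ k → k ≤ ℓ → 2 ^ r ≤ k ^ s → (r : ℝ) * Real.log 2 ≤ s * Real.log ℓ := by
    intro k r s hk hkl hrs
    rw [← Real.log_pow, ← Real.log_pow]
    apply Real.log_le_log (by positivity)
    have h1 : 2 ^ r ≤ ℓ ^ s := hrs.trans (Nat.pow_le_pow_left hkl _)
    exact_mod_cast h1
  have up : ∀ (c : ℝ) (k : ℕ), 0 ≤ c → c ≤ Real.log ℓ → (k : ℝ) < (c + 2) ^ 2 - 2 → k + 1 ≤ ℓ := by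
    intro c k hc hcl hk
    have h1 : (c + 2) ^ 2 ≤ (Real.log ℓ + 2) ^ 2 := by gcongr
    have h2 : (k : ℝ) < ℓ := by linarith
    have h3 : k < ℓ := by exact_mod_cast h2
    omega
  have a1 := up 0 1 le_rfl (Real.log_natCast_nonneg _) (by norm_num)
  have b1 := step 2 1 1 (by norm_num) a1 (by norm_num)
  have a2 := up 0.69 5 (by norm_num) (by norm_num at b1 ⊢; linarith) (by norm_num)
  have b2 := step 6 2 1 (by norm_num) a2 (by norm_num)
  have a3 := up 1.386 9 (by norm_num) (by norm_num at b2 ⊢; linarith) (by norm_num)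
  have b3 := step 10 3 1 (by norm_num) a3 (by norm_num)
  have a4 := up 2.079 14 (by norm_num) (by norm_num at b3 ⊢; linarith) (by norm_num)
  have b4 := step 15 7 2 (by norm_num) a4 (by norm_num)
  have a5 := up 2.42 17 (by norm_num) (by norm_num at b4 ⊢; linarith) (by norm_num)
  have b5 := step 18 4 1 (by norm_num) a5 (by norm_num)
  have a6 := up 2.772 20 (by norm_num) (by norm_num at b5 ⊢; linarith) (by norm_num)
  have b6 := step 21 21 5 (by norm_num) a6 (by norm_num)
  have a7 := up 2.911 22 (by norm_num) (by norm_num at b6 ⊢; linarith) (by norm_num)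
  have b7 := step 23 18 4 (by norm_num) a7 (by norm_num)
  norm_num at b7
  linarith

theorem harm_bound {x u ε A : ℝ} {L J : ℕ} (hε0 : 0 < ε) (hε1 : ε < 1) (hx : 4 < x)
    (hA0 : 0 < A) (hA : A ≤ 4 * x) (hL : x ^ 2 < L) (hu : u = Real.log L)
    (hεx : ε * (x - 1) ≤ u) (hJ : (L : ℝ) < A * (J + 1)) (hJ1 : 1 ≤ J) :
    8000 * ε * A < 999 * 192 * (harmonic J : ℝ) := by
  have hL0 : (0 : ℝ) < L := by nlinarith
  have h1 : ε * A < 4 * (u + 1) := by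
    have : ε * A ≤ ε * (4 * x) := by gcongr
    nlinarith
  rcases le_or_gt u 4.9 with hu1 | hu1
  · have h2 : (1 : ℝ) ≤ (harmonic J : ℝ) := by
      have h3 : (1 : ℚ) ≤ harmonic J := by
        unfold harmonic
        have := Finset.single_le_sum (f := fun i : ℕ => ((i + 1 : ℕ) : ℚ)⁻¹) (s := Finset.range J)
          (fun i _ => by positivity) (Finset.mem_range.2 (by omega : 0 < J))
        simpa using this
      exact_mod_cast h3
    linarith
  · have h2 := log_add_one_le_harmonic J
    have h3 : Real.log (L / A) ≤ Real.log ((J + 1 : ℕ) : ℝ) := by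
      apply Real.log_le_log (by positivity)
      rw [div_le_iff₀ hA0]
      push_cast
      linarith
    rw [Real.log_div hL0.ne' hA0.ne', ← hu] at h3
    have h4 : Real.log A ≤ Real.log 4 + Real.log x := by
      rw [← Real.log_mul (by norm_num) (by linarith)]
      exact Real.log_le_log hA0 hA
    have h5 : 2 * Real.log x ≤ u := by
      rw [hu]
      have : Real.log (x ^ 2) = 2 * Real.log x := by rw [Real.log_pow]; norm_num
      rw [← this]
      exact Real.log_le_log (by nlinarith) hL.le
    have h6 : Real.log 4 = 2 * Real.log 2 := by
      rw [show (4 : ℝ) = 2 ^ 2 by norm_num, Real.log_pow]; norm_num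
    have h7 := Real.log_two_lt_d9
    linarith

theorem sum_GP_le {n J c L : ℕ} {F : Type*} [Field F] [Fintype F] (hc : 0 < c) (hcJ : c * J ≤ L) :
    ∑ j ∈ Finset.range J, Nat.card {h : GL (Fin n) F // (h ∈ OG (1 : Matrix (Fin n) (Fin n) F) ∧
      (h : Matrix (Fin n) (Fin n) F).det = 1) ∧ GP (2 * (c * (j + 1))) h} ≤
    Nat.card {h : GL (Fin n) F //
        ((h : Matrix (Fin n) (Fin n) F)ᵀ * (h : Matrix (Fin n) (Fin n) F) = 1 ∧
          (h : Matrix (Fin n) (Fin n) F).det = 1) ∧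
        Even (orderOf h) ∧ orderOf (h ^ (orderOf h / 2)) = 2 ∧
        ((negOneEigDim F ((h ^ (orderOf h / 2) : GL (Fin n) F) :
            Matrix (Fin n) (Fin n) F) : ℤ) ≤ 2 * (L : ℤ))} := by
  rw [← Fin.sum_univ_eq_sum_range (fun j => Nat.card {h : GL (Fin n) F //
    (h ∈ OG (1 : Matrix (Fin n) (Fin n) F) ∧
      (h : Matrix (Fin n) (Fin n) F).det = 1) ∧ GP (2 * (c * (j + 1))) h}), ← Nat.card_sigma]
  refine Nat.card_le_card_of_injective (fun x => ⟨x.2.1, ?_⟩) ?_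
  · obtain ⟨j, h, ⟨h1, h2⟩, h3, h4, h5⟩ := x
    refine ⟨⟨mem_OG_one.1 h1, h2⟩, h3, h4, ?_⟩
    show ((negOneEigDim F ((h ^ (orderOf h / 2) : GL (Fin n) F) :
            Matrix (Fin n) (Fin n) F) : ℤ) ≤ 2 * (L : ℤ))
    rw [h5]
    have : c * ((j : ℕ) + 1) ≤ L := le_trans (Nat.mul_le_mul_left c j.2) hcJ
    exact_mod_cast Nat.mul_le_mul_left 2 this
  · rintro ⟨j, h, h1⟩ ⟨j', h', h1'⟩ hxy
    have e : h = h' := congrArg Subtype.val hxy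
    subst e
    have e2 : 2 * (c * ((j : ℕ) + 1)) = 2 * (c * ((j' : ℕ) + 1)) := h1.2.2.2.symm.trans h1'.2.2.2
    have e3 : (j : ℕ) = j' := by
      have := Nat.eq_of_mul_eq_mul_left hc (Nat.eq_of_mul_eq_mul_left two_pos e2)
      omega
    have e4 : j = j' := Fin.ext e3
    subst e4
    rfl

theorem stmt15 (ε : ℝ) (hε : ε ∈ Set.Ioo (0 : ℝ) 1) (ℓ : ℕ)
    (h1 : ⌈(Real.log ℓ + 1) ^ 2⌉ < ⌈(ℓ : ℝ) ^ ε⌉)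
    (h2 : ⌈(ℓ : ℝ) ^ ε⌉ ≤ (ℓ : ℤ) - 2 * ⌈Real.log ℓ⌉)
    (F : Type*) [Field F] [Fintype F] (hF : Odd (Fintype.card F))
    (n : ℕ) (hn : n = 2 * ℓ) :
    (Nat.card {h : GL (Fin n) F //
        ((h : Matrix (Fin n) (Fin n) F)ᵀ * (h : Matrix (Fin n) (Fin n) F) = 1 ∧
          (h : Matrix (Fin n) (Fin n) F).det = 1) ∧
        Even (orderOf h) ∧ orderOf (h ^ (orderOf h / 2)) = 2 ∧
        ((negOneEigDim F ((h ^ (orderOf h / 2) : GL (Fin n) F) :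
            Matrix (Fin n) (Fin n) F) : ℤ) ≤ 2 * ⌈(ℓ : ℝ) ^ ε⌉)} : ℝ) /
      Nat.card {h : GL (Fin n) F //
        (h : Matrix (Fin n) (Fin n) F)ᵀ * (h : Matrix (Fin n) (Fin n) F) = 1 ∧
          (h : Matrix (Fin n) (Fin n) F).det = 1} >
      ε / 192 := by
  obtain ⟨hε0, hε1⟩ := hε
  have hlog0 : 0 ≤ Real.log ℓ := Real.log_natCast_nonneg ℓ
  have hLpos : 0 < ⌈(ℓ : ℝ) ^ ε⌉ := lt_of_le_of_lt (Int.ceil_nonneg (by positivity)) h1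
  have hℓ1 : 1 ≤ ℓ := by
    have : 0 ≤ ⌈Real.log ℓ⌉ := Int.ceil_nonneg hlog0
    omega
  obtain ⟨L, hL⟩ := Int.eq_ofNat_of_zero_le hLpos.le
  rw [hL] at h1 h2 ⊢
  change _ < (L : ℤ) at h1
  change (L : ℤ) ≤ _ at h2
  have hcx := Int.le_ceil ((Real.log ℓ + 1) ^ 2)
  have hcl := Int.le_ceil (Real.log ℓ)
  have hLx : (Real.log ℓ + 1) ^ 2 + 1 ≤ L := by
    have h3 : ⌈(Real.log ℓ + 1) ^ 2⌉ + 1 ≤ (L : ℤ) := h1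
    have h4 : ((⌈(Real.log ℓ + 1) ^ 2⌉ : ℤ) : ℝ) + 1 ≤ (L : ℝ) := by exact_mod_cast h3
    linarith
  have hLℓ : (L : ℝ) + 2 * Real.log ℓ ≤ ℓ := by
    have h4 : ((L : ℤ) : ℝ) ≤ (((ℓ : ℤ) - 2 * ⌈Real.log ℓ⌉ : ℤ) : ℝ) := by exact_mod_cast h2
    push_cast at h4
    linarith
  have hlog3 : 3 < Real.log ℓ := boot hℓ1 (by nlinarith)
  have hLleℓ : L ≤ ℓ := by
    have : (L : ℝ) ≤ ℓ := by linarith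
    exact_mod_cast this
  set x := Real.log ℓ + 1 with hx
  obtain ⟨a', ha1, ha2⟩ := exists_nat_pow_near (x := 2 * x) (y := (2 : ℝ)) (by linarith) (by norm_num)
  set a := a' + 1 with ha
  have hA4 : (2 : ℝ) ^ a ≤ 4 * x := by rw [ha, pow_succ]; linarith
  have ha3 : 4 ≤ a := by
    by_contra hcon
    have : (2 : ℝ) ^ a ≤ 2 ^ 3 := pow_le_pow_right₀ (by norm_num) (by omega)
    norm_num at this
    linarith
  have h16 : 16 ≤ 2 ^ a := by
    calc 16 = 2 ^ 4 := by norm_num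
      _ ≤ 2 ^ a := Nat.pow_le_pow_right (by norm_num) ha3
  obtain ⟨t, ht2, hta, hta', ht'⟩ := exists_t hF Fintype.one_lt_card (a := a) (by omega)
  set J := L / 2 ^ a with hJ
  have hAL : 2 ^ a ≤ L := by
    have : (2 : ℝ) ^ a ≤ L := by nlinarith
    exact_mod_cast this
  have hJ1 : 1 ≤ J := Nat.div_pos hAL (by positivity)
  have hAJ : 2 ^ a * J ≤ L := Nat.mul_div_le L (2 ^ a)
  have hJL : (L : ℝ) < 2 ^ a * (J + 1) := by
    have : L < 2 ^ a * (J + 1) := Nat.lt_mul_div_succ L (by positivity)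
    exact_mod_cast this
  have hharm := harm_bound (x := x) (u := Real.log L) (ε := ε) (A := 2 ^ a) (L := L) (J := J)
    hε0 hε1 (by linarith) (by positivity) hA4 (by linarith) rfl (by
      have h5 : x - 1 = Real.log ℓ := by rw [hx]; ring
      have hℓ0 : (0 : ℝ) < ℓ := by exact_mod_cast hℓ1
      rw [h5, ← Real.log_rpow hℓ0]
      apply Real.log_le_log (by positivity)
      have h6 := Int.le_ceil ((ℓ : ℝ) ^ ε)
      rw [hL] at h6
      exact_mod_cast h6) hJL hJ1
  have hN : Nat.card {h : GL (Fin n) F //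
        (h : Matrix (Fin n) (Fin n) F)ᵀ * (h : Matrix (Fin n) (Fin n) F) = 1 ∧
          (h : Matrix (Fin n) (Fin n) F).det = 1} =
      Nat.card {h : GL (Fin n) F // h ∈ OG (1 : Matrix (Fin n) (Fin n) F) ∧
        (h : Matrix (Fin n) (Fin n) F).det = 1} :=
    Nat.card_congr (Equiv.subtypeEquivRight (fun h => by rw [mem_OG_one]))
  rw [hN]
  have hN0 : 0 < Nat.card {h : GL (Fin n) F // h ∈ OG (1 : Matrix (Fin n) (Fin n) F) ∧
        (h : Matrix (Fin n) (Fin n) F).det = 1} := by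
    have : Nonempty {h : GL (Fin n) F // h ∈ OG (1 : Matrix (Fin n) (Fin n) F) ∧
        (h : Matrix (Fin n) (Fin n) F).det = 1} := ⟨⟨1, Subgroup.one_mem _, by simp⟩⟩
    exact Nat.card_pos
  have hsum := sum_GP_le (n := n) (J := J) (c := 2 ^ a) (L := L) (F := F) (by positivity) hAJ
  have hgood : ∀ j ∈ Finset.range J, 999 * Nat.card {h : GL (Fin n) F // h ∈ OG (1 : Matrix (Fin n) (Fin n) F) ∧
        (h : Matrix (Fin n) (Fin n) F).det = 1} ≤
    8000 * (2 ^ a * (j + 1)) * Nat.card {h : GL (Fin n) F // (h ∈ OG (1 : Matrix (Fin n) (Fin n) F) ∧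
      (h : Matrix (Fin n) (Fin n) F).det = 1) ∧ GP (2 * (2 ^ a * (j + 1))) h} := by
    intro j hj
    have hj' := Finset.mem_range.1 hj
    refine good_m hn hF (by omega) (by omega) hta hta' ht' (by linarith) ?_ (Dvd.intro _ rfl) ?_
    · nlinarith
    · exact (Nat.mul_le_mul_left _ (by omega)).trans (hAJ.trans hLleℓ)
  set N := Nat.card {h : GL (Fin n) F // h ∈ OG (1 : Matrix (Fin n) (Fin n) F) ∧
        (h : Matrix (Fin n) (Fin n) F).det = 1}
  change _ > _
  have hN0' : (0 : ℝ) < N := by exact_mod_cast hN0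
  rw [gt_iff_lt, lt_div_iff₀ hN0']
  refine lt_of_lt_of_le ?_ (Nat.cast_le.2 hsum)
  rw [Nat.cast_sum]
  have h7 : ∀ j ∈ Finset.range J, 999 * (N : ℝ) / (8000 * 2 ^ a) * ((j + 1 : ℕ) : ℝ)⁻¹ ≤
      ((Nat.card {h : GL (Fin n) F // (h ∈ OG (1 : Matrix (Fin n) (Fin n) F) ∧
      (h : Matrix (Fin n) (Fin n) F).det = 1) ∧ GP (2 * (2 ^ a * (j + 1))) h} : ℕ) : ℝ) := by
    intro j hj
    have h8 := hgood j hj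
    set G := Nat.card {h : GL (Fin n) F // (h ∈ OG (1 : Matrix (Fin n) (Fin n) F) ∧
      (h : Matrix (Fin n) (Fin n) F).det = 1) ∧ GP (2 * (2 ^ a * (j + 1))) h}
    have h9 : (999 : ℝ) * N ≤ 8000 * (2 ^ a * (j + 1)) * G := by exact_mod_cast h8
    rw [← div_eq_mul_inv, div_div, div_le_iff₀ (by positivity)]
    push_cast
    linarith
  refine lt_of_lt_of_le ?_ (Finset.sum_le_sum h7)
  rw [← Finset.mul_sum]
  have h10 : ∑ i ∈ Finset.range J, ((i + 1 : ℕ) : ℝ)⁻¹ = (harmonic J : ℝ) := by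
    simp [harmonic]
  rw [h10, div_mul_eq_mul_div, div_mul_eq_mul_div, div_lt_div_iff₀ (by norm_num) (by positivity)]
  have := mul_lt_mul_of_pos_right hharm hN0'
  linarith
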